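/- arXiv:1911.11747 — 7 statements merged into one kernel-verified Lean document; each statement's English description precedes it below -/
import Mathlib

section
/- If a committee W is priceable for an election instance (P,k), then W provides proportional justified representation: for every integer ℓ ≥ 1 and every group of voters S ⊆ N such that |⋂_{i∈S} A_i| ≥ ℓ and |S| ≥ ℓ·n/|W|, the committee W contains at least ℓ candidates from ⋃_{i∈S} A_i. -/
/-!
Common framework for approval-based committee elections
(Peters & Skowron, "Proportionality and the Limits of Welfarism").
-/

namespace ABC

/-- An election instance: a finite set `C` of candidates, a finite set `N` of voters,
an approval ballot `A i ⊆ C` for each voter `i`, and a committee size `k`. -/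
structure Election where
  C : Finset ℕ
  N : Finset ℕ
  A : ℕ → Finset ℕ
  k : ℕ

/-- Basic well-formedness of an election instance: ballots are sets of candidates,
`k ≤ |C|`, and the instance is nondegenerate (`k ≥ 1`, `n ≥ 1`). -/
def Election.Valid (E : Election) : Prop :=
  (∀ i ∈ E.N, E.A i ⊆ E.C) ∧ E.k ≤ E.C.card ∧ 0 < E.k ∧ 0 < E.N.card

/-- `C(P)`: the set of candidates approved by at least one voter. -/
def Election.CP (E : Election) : Finset ℕ := E.N.biUnion E.A

/-- The price `n/k`. -/
noncomputable def Election.price (E : Election) : ℝ := (E.N.card : ℝ) / (E.k : ℝ)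

/-- `N(c)`: the set of voters approving candidate `c`. -/
def Election.approvers (E : Election) (c : ℕ) : Finset ℕ :=
  E.N.filter (fun i => c ∈ E.A i)

/-- A committee: a set of at most `k` candidates. -/
def Election.IsCommittee (E : Election) (W : Finset ℕ) : Prop :=
  W ⊆ E.C ∧ W.card ≤ E.k

/-- The set of candidates approved by every voter in `S` (i.e. `⋂_{i ∈ S} A_i`). -/
def commonApproved (E : Election) (S : Finset ℕ) : Finset ℕ :=
  E.C.filter (fun c => ∀ i ∈ S, c ∈ E.A i)

/-! ### Price systems and priceability -/

/-- A price system: a positive price `p` and payment functions `pay i : C → [0,1]`,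
where voter `i` pays only for candidates she approves and spends at most one dollar. -/
structure PriceSystem (E : Election) where
  p : ℝ
  pay : ℕ → ℕ → ℝ
  p_pos : 0 < p
  pay_nonneg : ∀ i c, 0 ≤ pay i c
  pay_le_one : ∀ i c, pay i c ≤ 1
  pay_approved : ∀ i ∈ E.N, ∀ c : ℕ, 0 < pay i c → c ∈ E.A i
  pay_budget : ∀ i ∈ E.N, ∑ c ∈ E.C, pay i c ≤ 1

/-- The price system supports the committee `W`: every elected candidate receives
total payment `p`, unelected candidates receive nothing, and the supporters of an
unelected candidate have at most `p` unspent budget in total. -/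
def PriceSystem.SupportsW {E : Election} (ps : PriceSystem E) (W : Finset ℕ) : Prop :=
  (∀ c ∈ W, ∑ i ∈ E.N, ps.pay i c = ps.p) ∧
  (∀ c : ℕ, c ∉ W → ∑ i ∈ E.N, ps.pay i c = 0) ∧
  (∀ c ∈ E.C, c ∉ W →
    ∑ i ∈ E.approvers c, (1 - ∑ c' ∈ W, ps.pay i c') ≤ ps.p)

/-- A committee is priceable if some price system supports it. -/
def Priceable (E : Election) (W : Finset ℕ) : Prop :=
  ∃ ps : PriceSystem E, ps.SupportsW W

/-! ### Phragmén's sequential rule, via execution traces -/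

/-- An execution trace of Phragmén's sequential rule: `elected j` is the candidate
elected in step `j` (for `j < k`), at time `time j`; `reset j i` is the time at which
voter `i`'s balance was last reset before step `j` (so her balance at time `t` is
`t - reset j i`).  A candidate is elected at the first moment at which its approvers
jointly hold `n/k` dollars.  -/
structure PhragmenTrace (E : Election) where
  elected : ℕ → ℕ
  time : ℕ → ℝ
  reset : ℕ → ℕ → ℝ
  elected_mem : ∀ j < E.k, elected j ∈ E.C
  elected_inj : ∀ j < E.k, ∀ j' < E.k, elected j = elected j' → j = j'
  time_nonneg : ∀ j, 0 ≤ time j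
  time_mono : ∀ j j', j ≤ j' → time j ≤ time j'
  reset_zero : ∀ i, reset 0 i = 0
  reset_succ : ∀ j i, reset (j + 1) i = if elected j ∈ E.A i then time j else reset j i
  /-- the elected candidate's approvers jointly hold exactly `n/k` at the election time -/
  elect_eq : ∀ j < E.k, ∑ i ∈ E.approvers (elected j), (time j - reset j i) = E.price
  /-- no not-yet-elected candidate's approvers held more than `n/k` at any earlier moment -/
  first : ∀ j < E.k, ∀ c ∈ E.C, (∀ j' < j, elected j' ≠ c) →
    ∑ i ∈ E.approvers c, (time j - reset j i) ≤ E.price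

/-- `W` is a possible output of Phragmén's sequential rule (under some tie-breaking). -/
def PhragmenOutput (E : Election) (W : Finset ℕ) : Prop :=
  ∃ tr : PhragmenTrace E, W = (Finset.range E.k).image tr.elected

/-! ### Rule X -/

/-- Candidate `c` (not yet elected) is `q`-affordable given budgets `b`:
its approvers can raise `n/k` while each paying at most `q`. -/
def Affordable (E : Election) (b : ℕ → ℝ) (W : Finset ℕ) (c : ℕ) (q : ℝ) : Prop :=
  c ∈ E.C ∧ c ∉ W ∧ 0 ≤ q ∧ E.price ≤ ∑ i ∈ E.approvers c, min q (b i)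

/-- Reachable states of Rule X: starting from budgets all equal to `1` and the empty
committee, repeatedly add a candidate that is `q`-affordable for the minimum possible `q`
(ties broken arbitrarily), charging each approver `min q (b i)`. -/
inductive RuleXReach (E : Election) : (ℕ → ℝ) → Finset ℕ → Prop
  | init : RuleXReach E (fun _ => 1) ∅
  | step {b : ℕ → ℝ} {W : Finset ℕ} {c : ℕ} {q : ℝ} :
      RuleXReach E b W →
      Affordable E b W c q →
      (∀ c' q', Affordable E b W c' q' → q ≤ q') →
      RuleXReach E (fun i => if i ∈ E.approvers c then b i - min q (b i) else b i)
        (insert c W)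

/-- `W` is a possible output of Rule X (under some tie-breaking): a reachable
committee from which no further candidate is `q`-affordable for any `q`. -/
def RuleXOutput (E : Election) (W : Finset ℕ) : Prop :=
  ∃ b : ℕ → ℝ, RuleXReach E b W ∧ ∀ c q, ¬ Affordable E b W c q

/-! ### Proportional Approval Voting -/

/-- The harmonic number `H(t) = 1 + 1/2 + ⋯ + 1/t` (with `H(0) = 0`). -/
noncomputable def hsum (t : ℕ) : ℝ := ∑ j ∈ Finset.range t, (1 : ℝ) / (j + 1)

/-- The PAV score of a committee. -/
noncomputable def pavScore (E : Election) (W : Finset ℕ) : ℝ :=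
  ∑ i ∈ E.N, hsum ((E.A i ∩ W).card)

/-- `W` is a PAV winning committee: it has maximal PAV score among committees of size at
most `k`. -/
def PavWinner (E : Election) (W : Finset ℕ) : Prop :=
  W ⊆ E.C ∧ W.card ≤ E.k ∧
  ∀ W' : Finset ℕ, W' ⊆ E.C → W'.card ≤ E.k → pavScore E W' ≤ pavScore E W

/-! ### The core and its approximations -/

/-- `W` is in the core: no nonempty group `S` of voters together with a set `T` of
candidates with `|T|/k ≤ |S|/n` gives every member of `S` strictly more approved
candidates than `W` does. -/
def InCore (E : Election) (W : Finset ℕ) : Prop :=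
  ¬ ∃ S T : Finset ℕ, S ⊆ E.N ∧ S.Nonempty ∧ T ⊆ E.C ∧
    T.card * E.N.card ≤ S.card * E.k ∧
    ∀ i ∈ S, (E.A i ∩ W).card < (E.A i ∩ T).card

/-- `W` is in the `λ`-core: no nonempty group `S` and set `T` with `|T|/k ≤ |S|/n`
and `|A_i ∩ T| > max (λ·|A_i ∩ W|) 1` for every `i ∈ S`. -/
def InLamCore (lam : ℝ) (E : Election) (W : Finset ℕ) : Prop :=
  ¬ ∃ S T : Finset ℕ, S ⊆ E.N ∧ S.Nonempty ∧ T ⊆ E.C ∧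
    T.card * E.N.card ≤ S.card * E.k ∧
    ∀ i ∈ S, max (lam * ((E.A i ∩ W).card : ℝ)) 1 < ((E.A i ∩ T).card : ℝ)

/-! ### Pigou–Dalton transfers -/

/-- `W` admits a Pigou–Dalton transfer: there is a committee `W'` of the same size and
voters `i, j` with `|A_j∩W| > |A_i∩W|` such that all other voters' utilities are
unchanged in `W'`, the combined utility of `i` and `j` is unchanged, and
`|A_j∩W| > |A_j∩W'| ≥ |A_i∩W'| > |A_i∩W|`. -/
def AdmitsPD (E : Election) (W : Finset ℕ) : Prop :=
  ∃ W' : Finset ℕ, W' ⊆ E.C ∧ W'.card = W.card ∧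
  ∃ i ∈ E.N, ∃ j ∈ E.N, i ≠ j ∧
    (E.A i ∩ W).card < (E.A j ∩ W).card ∧
    (∀ l ∈ E.N, l ≠ i → l ≠ j → (E.A l ∩ W').card = (E.A l ∩ W).card) ∧
    (E.A i ∩ W').card + (E.A j ∩ W').card = (E.A i ∩ W).card + (E.A j ∩ W).card ∧
    (E.A j ∩ W').card < (E.A j ∩ W).card ∧
    (E.A i ∩ W').card ≤ (E.A j ∩ W').card ∧
    (E.A i ∩ W).card < (E.A i ∩ W').card

/-! ### Laminar instances and laminar proportionality -/

/-- All ballots are equal. -/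
def Unanimous (E : Election) : Prop := ∀ i ∈ E.N, ∀ j ∈ E.N, E.A i = E.A j

/-- `P₋c`: remove candidate `c` from every ballot; the committee size drops by one. -/
def eraseCand (E : Election) (c : ℕ) : Election :=
  { C := E.C.erase c, N := E.N, A := fun i => (E.A i).erase c, k := E.k - 1 }

/-- `E` is the concatenation of two instances `E₁`, `E₂` on disjoint voter sets and
disjoint candidate sets, with `k = k₁ + k₂` and `n₁/k₁ = n₂/k₂`. -/
def Combines (E E₁ E₂ : Election) : Prop :=
  Disjoint E₁.N E₂.N ∧ Disjoint E₁.CP E₂.CP ∧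
  E.N = E₁.N ∪ E₂.N ∧
  (∀ i ∈ E₁.N, E.A i = E₁.A i) ∧ (∀ i ∈ E₂.N, E.A i = E₂.A i) ∧
  E.k = E₁.k + E₂.k ∧ 0 < E₁.k ∧ 0 < E₂.k ∧
  E₁.N.card * E₂.k = E₂.N.card * E₁.k

/-- Laminar election instances. -/
inductive Laminar : Election → Prop
  | unanimous (E : Election) : Unanimous E → E.k ≤ E.CP.card → Laminar E
  | consensus (E : Election) (c : ℕ) : 0 < E.k → c ∈ E.CP →
      (∀ i ∈ E.N, c ∈ E.A i) →
      ¬ Unanimous (eraseCand E c) → Laminar (eraseCand E c) → Laminar E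
  | combine (E E₁ E₂ : Election) : Combines E E₁ E₂ →
      Laminar E₁ → Laminar E₂ → Laminar E

/-- Laminar proportional committees for a laminar instance. -/
inductive LamProp : Election → Finset ℕ → Prop
  | unanimous (E : Election) (W : Finset ℕ) :
      Unanimous E → W ⊆ E.CP → W.card = E.k → LamProp E W
  | consensus (E : Election) (c : ℕ) (W' : Finset ℕ) : 0 < E.k → c ∈ E.CP →
      (∀ i ∈ E.N, c ∈ E.A i) → Laminar (eraseCand E c) →
      LamProp (eraseCand E c) W' → c ∉ W' → LamProp E (insert c W')
  | combine (E E₁ E₂ : Election) (W₁ W₂ : Finset ℕ) : Combines E E₁ E₂ →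
      LamProp E₁ W₁ → LamProp E₂ W₂ → LamProp E (W₁ ∪ W₂)

/-! ### Committee rules and welfarism -/

/-- The welfare vector of `W`: each voter's number of approved committee members
(indexed by voter name, `0` outside `N`). -/
def wvec (E : Election) (W : Finset ℕ) : ℕ → ℕ :=
  fun i => if i ∈ E.N then (E.A i ∩ W).card else 0

/-- A committee rule returns, on every (valid) instance, a nonempty set of committees
of size at most `k`. -/
def CommitteeRule (f : Election → Set (Finset ℕ)) : Prop :=
  ∀ E : Election, E.Valid → (f E).Nonempty ∧ ∀ W ∈ f E, W ⊆ E.C ∧ W.card ≤ E.k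

/-- A rule is welfarist if for each committee size `k` there is a function `g k` of the
welfare vector such that on every instance the rule returns exactly the size-`k`
committees maximizing `g k` of their welfare vector. -/
def Welfarist (f : Election → Set (Finset ℕ)) : Prop :=
  ∃ g : ℕ → (ℕ → ℕ) → ℝ, ∀ E : Election, E.Valid →
    f E = { W : Finset ℕ | W ⊆ E.C ∧ W.card = E.k ∧
      ∀ W' : Finset ℕ, W' ⊆ E.C → W'.card = E.k →
        g E.k (wvec E W') ≤ g E.k (wvec E W) }

/-- Pareto-optimality of a rule. -/
def ParetoOptimal (f : Election → Set (Finset ℕ)) : Prop :=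
  ∀ E : Election, E.Valid → ∀ W ∈ f E,
    ¬ ∃ W' : Finset ℕ, W' ⊆ E.C ∧ W'.card ≤ E.k ∧
      (∀ i ∈ E.N, (E.A i ∩ W).card ≤ (E.A i ∩ W').card) ∧
      (∃ i ∈ E.N, (E.A i ∩ W).card < (E.A i ∩ W').card)

/-! ### Party-list profiles -/

/-- A party-list profile: any two ballots are equal or disjoint. -/
def PartyList (E : Election) : Prop :=
  ∀ i ∈ E.N, ∀ j ∈ E.N, E.A i = E.A j ∨ Disjoint (E.A i) (E.A j)

/-- The number of voters supporting the party with ballot `B`. -/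
def nParty (E : Election) (B : Finset ℕ) : ℕ :=
  (E.N.filter (fun i => E.A i = B)).card

/-! ### Priceability with equal payments -/

/-- `T` is priceable with equal payments in the instance restricted to the voters in `S`
with committee size `|T|`: payments are in `[0,1]`, only for approved candidates,
each voter spends at most `1` on `T`, every `c ∈ T` receives exactly `|S|/|T|` in total,
and all voters paying for `c` pay the same amount. -/
def PriceableEq (E : Election) (S T : Finset ℕ) : Prop :=
  ∃ pay : ℕ → ℕ → ℝ,
    (∀ i c, 0 ≤ pay i c ∧ pay i c ≤ 1) ∧
    (∀ i ∈ S, ∀ c : ℕ, 0 < pay i c → c ∈ E.A i) ∧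
    (∀ i ∈ S, ∑ c ∈ T, pay i c ≤ 1) ∧
    (∀ c ∈ T, ∑ i ∈ S, pay i c = (S.card : ℝ) / (T.card : ℝ)) ∧
    (∀ c ∈ T, ∀ i ∈ S, ∀ j ∈ S, c ∈ E.A i → c ∈ E.A j → pay i c = pay j c)


/-- The budget of voter `i` left unspent after paying for the committee `W`. -/
def PriceSystem.unspent {E : Election} (ps : PriceSystem E) (W : Finset ℕ) (i : ℕ) : ℝ :=
  1 - ∑ c ∈ W, ps.pay i c

theorem PriceSystem.unspent_nonneg {E : Election} (ps : PriceSystem E) {W : Finset ℕ}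
    (hWC : W ⊆ E.C) {i : ℕ} (hi : i ∈ E.N) : 0 ≤ ps.unspent W i :=
  sub_nonneg.2 <| (Finset.sum_le_sum_of_subset_of_nonneg hWC
    fun c _ _ => ps.pay_nonneg i c).trans (ps.pay_budget i hi)

theorem PriceSystem.SupportsW.sum_unspent {E : Election} {ps : PriceSystem E} {W : Finset ℕ}
    (h : ps.SupportsW W) :
    ∑ i ∈ E.N, ps.unspent W i = E.N.card - W.card * ps.p := by
  simp only [PriceSystem.unspent, Finset.sum_sub_distrib]
  rw [Finset.sum_comm, Finset.sum_congr rfl h.1]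
  simp

/-- A group of voters spends money only on those elected candidates that some of its members
approve, and at most the price on each of them. -/
theorem PriceSystem.SupportsW.le_sum_unspent {E : Election} {ps : PriceSystem E}
    {W S : Finset ℕ} (h : ps.SupportsW W) (hSN : S ⊆ E.N) :
    (S.card : ℝ) - (W ∩ S.biUnion E.A).card * ps.p ≤ ∑ i ∈ S, ps.unspent W i := by
  have hzero : ∀ c ∈ W, c ∉ W ∩ S.biUnion E.A → ∑ i ∈ S, ps.pay i c = 0 := by
    intro c hc hcU
    refine Finset.sum_eq_zero fun i hi => ?_
    by_contra hne
    have hpos := lt_of_le_of_ne (ps.pay_nonneg i c) (Ne.symm hne)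
    exact hcU (Finset.mem_inter.2
      ⟨hc, Finset.mem_biUnion.2 ⟨i, hi, ps.pay_approved i (hSN hi) c hpos⟩⟩)
  have hspent : ∑ c ∈ W, ∑ i ∈ S, ps.pay i c ≤ (W ∩ S.biUnion E.A).card * ps.p := by
    rw [← Finset.sum_subset Finset.inter_subset_left hzero, ← nsmul_eq_mul]
    refine Finset.sum_le_card_nsmul _ _ _ fun c hc => ?_
    rw [← h.1 c (Finset.mem_inter.1 hc).1]
    exact Finset.sum_le_sum_of_subset_of_nonneg hSN fun i _ _ => ps.pay_nonneg i c
  simp only [PriceSystem.unspent, Finset.sum_sub_distrib]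
  rw [Finset.sum_comm, Finset.sum_const, nsmul_one]
  exact sub_le_sub_left hspent _

/-- If a committee `W` is priceable, then it provides proportional
justified representation: for every `ℓ ≥ 1` and every group `S ⊆ N` of voters with
`|⋂_{i∈S} A_i| ≥ ℓ` and `|S| ≥ ℓ·n/|W|`, the committee `W` contains at least `ℓ`
candidates from `⋃_{i∈S} A_i`. -/
theorem priceable_implies_PJR (E : Election) (hE : E.Valid)
    (W : Finset ℕ) (hWC : W ⊆ E.C) (hWk : W.card ≤ E.k)
    (hP : Priceable E W)
    (l : ℕ) (hl : 1 ≤ l) (S : Finset ℕ) (hSN : S ⊆ E.N) (hSne : S.Nonempty)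
    (hcohesive : l ≤ (commonApproved E S).card)
    (hlarge : (l : ℝ) * (E.N.card : ℝ) ≤ (S.card : ℝ) * (W.card : ℝ)) :
    l ≤ (W ∩ S.biUnion E.A).card := by
  obtain ⟨ps, hps⟩ := hP
  by_contra! hlt
  obtain ⟨c, hc, hcW⟩ : ∃ c ∈ commonApproved E S, c ∉ W := by
    by_contra! hsub
    obtain ⟨i, hi⟩ := hSne
    refine absurd (Finset.card_le_card fun c hc => ?_) (hlt.trans_le hcohesive).not_ge
    exact Finset.mem_inter.2
      ⟨hsub c hc, Finset.mem_biUnion.2 ⟨i, hi, (Finset.mem_filter.1 hc).2 i hi⟩⟩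
  obtain ⟨hcC, hcS⟩ := Finset.mem_filter.1 hc
  have hSp : ∑ i ∈ S, ps.unspent W i ≤ ps.p :=
    (Finset.sum_le_sum_of_subset_of_nonneg
      (fun i hi => Finset.mem_filter.2 ⟨hSN hi, hcS i hi⟩)
      fun i hi _ => ps.unspent_nonneg hWC (Finset.mem_filter.1 hi).1).trans
      (hps.2.2 c hcC hcW)
  have hSn : ∑ i ∈ S, ps.unspent W i ≤ E.N.card - W.card * ps.p :=
    (Finset.sum_le_sum_of_subset_of_nonneg hSN
      fun i hi _ => ps.unspent_nonneg hWC hi).trans_eq hps.sum_unspent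
  have hge := hps.le_sum_unspent hSN
  have hm : ((W ∩ S.biUnion E.A).card : ℝ) + 1 ≤ l := by exact_mod_cast hlt
  have hmp := mul_le_mul_of_nonneg_right hm ps.p_pos.le
  have hp := ps.p_pos
  have hl0 : (0 : ℝ) < l := by exact_mod_cast hl
  have hn : (0 : ℝ) < E.N.card := by exact_mod_cast hE.2.2.2
  have hw : (0 : ℝ) ≤ W.card := Nat.cast_nonneg _
  have hSl : (S.card : ℝ) ≤ l * ps.p := by linarith
  have hnp : (E.N.card : ℝ) ≤ W.card * ps.p := by
    refine le_of_mul_le_mul_left ?_ hl0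
    calc (l : ℝ) * E.N.card ≤ S.card * W.card := hlarge
      _ ≤ l * ps.p * W.card := mul_le_mul_of_nonneg_right hSl hw
      _ = l * (W.card * ps.p) := by ring
  -- All budgets are exhausted, so `S` has spent all its money on fewer than `l` candidates.
  have hwpos : (0 : ℝ) < W.card := pos_of_mul_pos_left (hn.trans_le hnp) hp.le
  have hSlt : (S.card : ℝ) < l * ps.p := by linarith
  have hle : (W.card : ℝ) * ps.p ≤ E.N.card := by
    rw [← sub_nonneg, ← hps.sum_unspent]
    exact Finset.sum_nonneg fun i hi => ps.unspent_nonneg hWC hi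
  refine absurd hlarge (not_le.2 ?_)
  calc (S.card : ℝ) * W.card < l * ps.p * W.card := mul_lt_mul_of_pos_right hSlt hwpos
    _ = l * (W.card * ps.p) := by ring
    _ ≤ l * E.N.card := mul_le_mul_of_nonneg_left hle hl0.le

end ABC
end

section
/- Every committee output by Phragmén's sequential rule (under any tie-breaking) is priceable. -/
/-!
Common framework for approval-based committee elections
(Peters & Skowron, "Proportionality and the Limits of Welfarism").
-/

namespace ABC

namespace PhragmenTrace

variable {E : Election} (tr : PhragmenTrace E)

/-- The amount voter `i` spends on the candidate elected in step `j`. -/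
noncomputable def spent (i j : ℕ) : ℝ :=
  if tr.elected j ∈ E.A i then tr.time j - tr.reset j i else 0

lemma reset_succ_eq_add_spent (j i : ℕ) :
    tr.reset (j + 1) i = tr.reset j i + tr.spent i j := by
  rw [tr.reset_succ, spent]
  split_ifs <;> ring

lemma sum_spent (m i : ℕ) : ∑ j ∈ Finset.range m, tr.spent i j = tr.reset m i := by
  induction m with
  | zero => simp [tr.reset_zero]
  | succ m ih => rw [Finset.sum_range_succ, ih, reset_succ_eq_add_spent]

lemma reset_succ_le_time (j i : ℕ) : tr.reset (j + 1) i ≤ tr.time j := by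
  induction j with
  | zero =>
    rw [tr.reset_succ, tr.reset_zero]
    split_ifs
    exacts [le_rfl, tr.time_nonneg 0]
  | succ j ih =>
    rw [tr.reset_succ]
    split_ifs
    exacts [le_rfl, ih.trans (tr.time_mono _ _ j.le_succ)]

lemma reset_le_time (j i : ℕ) : tr.reset j i ≤ tr.time j := by
  cases j with
  | zero => rw [tr.reset_zero]; exact tr.time_nonneg 0
  | succ j => exact (tr.reset_succ_le_time j i).trans (tr.time_mono _ _ j.le_succ)

lemma spent_nonneg (i j : ℕ) : 0 ≤ tr.spent i j := by
  rw [spent]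
  split_ifs
  exacts [sub_nonneg.2 (tr.reset_le_time j i), le_rfl]

/-- The amount voter `i` spends on candidate `c` during the whole execution. -/
noncomputable def spentOn (i c : ℕ) : ℝ :=
  ∑ j ∈ Finset.range E.k with tr.elected j = c, tr.spent i j

lemma spentOn_nonneg (i c : ℕ) : 0 ≤ tr.spentOn i c :=
  Finset.sum_nonneg fun j _ => tr.spent_nonneg i j

lemma spentOn_le_reset (i c : ℕ) : tr.spentOn i c ≤ tr.reset E.k i := by
  rw [← tr.sum_spent, spentOn]
  exact Finset.sum_le_sum_of_subset_of_nonneg (Finset.filter_subset _ _)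
    fun j _ _ => tr.spent_nonneg i j

lemma sum_spentOn {S : Finset ℕ} (hS : ∀ j < E.k, tr.elected j ∈ S) (i : ℕ) :
    ∑ c ∈ S, tr.spentOn i c = tr.reset E.k i := by
  rw [← tr.sum_spent]
  exact Finset.sum_fiberwise_of_maps_to (fun j hj => hS j (Finset.mem_range.1 hj)) _

lemma spentOn_eq_zero_of_notMem {i c : ℕ} (hc : c ∉ E.A i) : tr.spentOn i c = 0 := by
  refine Finset.sum_eq_zero fun j hj => ?_
  rw [← (Finset.mem_filter.1 hj).2] at hc
  exact if_neg hc

lemma spentOn_eq_zero_of_not_elected {c : ℕ} (hc : ∀ j < E.k, tr.elected j ≠ c) (i : ℕ) :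
    tr.spentOn i c = 0 := by
  rw [spentOn, Finset.filter_false_of_mem fun j hj => hc j (Finset.mem_range.1 hj),
    Finset.sum_empty]

lemma spentOn_elected {j : ℕ} (hj : j < E.k) (i : ℕ) :
    tr.spentOn i (tr.elected j) = tr.spent i j := by
  have h : {l ∈ Finset.range E.k | tr.elected l = tr.elected j} = {j} := by
    ext l
    simp only [Finset.mem_filter, Finset.mem_range, Finset.mem_singleton]
    exact ⟨fun h => tr.elected_inj l h.1 j hj h.2, by rintro rfl; exact ⟨hj, rfl⟩⟩
  rw [spentOn, h, Finset.sum_singleton]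

lemma sum_spentOn_elected {j : ℕ} (hj : j < E.k) :
    ∑ i ∈ E.N, tr.spentOn i (tr.elected j) = E.price := by
  rw [← tr.elect_eq j hj, Election.approvers, Finset.sum_filter]
  exact Finset.sum_congr rfl fun i _ => tr.spentOn_elected hj i

lemma time_pos (hE : 0 < E.price) (hk : 0 < E.k) (j : ℕ) : 0 < tr.time j := by
  refine lt_of_lt_of_le (lt_of_le_of_ne (tr.time_nonneg 0) fun h => ?_)
    (tr.time_mono 0 j j.zero_le)
  have h0 := tr.elect_eq 0 hk
  simp only [← h, tr.reset_zero, sub_zero, Finset.sum_const_zero] at h0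
  exact hE.ne h0

/-- The price system in which every voter pays what she spends during the execution,
with budgets normalized by the time of the last election. -/
noncomputable def priceSystem (hE : E.Valid) : PriceSystem E :=
  have hp : 0 < E.price := div_pos (Nat.cast_pos.2 hE.2.2.2) (Nat.cast_pos.2 hE.2.2.1)
  have hT : 0 < tr.time (E.k - 1) := tr.time_pos hp hE.2.2.1 _
  have hreset (i : ℕ) : tr.reset E.k i ≤ tr.time (E.k - 1) := by
    have h := tr.reset_succ_le_time (E.k - 1) i
    rwa [Nat.sub_add_cancel hE.2.2.1] at h
  { p := E.price / tr.time (E.k - 1)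
    pay := fun i c => tr.spentOn i c / tr.time (E.k - 1)
    p_pos := div_pos hp hT
    pay_nonneg := fun i c => div_nonneg (tr.spentOn_nonneg i c) hT.le
    pay_le_one := fun i c => (div_le_one hT).2 ((tr.spentOn_le_reset i c).trans (hreset i))
    pay_approved := fun i _ c h => by
      by_contra hc
      rw [tr.spentOn_eq_zero_of_notMem hc, zero_div] at h
      exact h.false
    pay_budget := fun i _ => by
      rw [← Finset.sum_div, tr.sum_spentOn tr.elected_mem]
      exact (div_le_one hT).2 (hreset i) }

lemma priceSystem_supportsW (hE : E.Valid) :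
    (tr.priceSystem hE).SupportsW ((Finset.range E.k).image tr.elected) := by
  have hk : 0 < E.k := hE.2.2.1
  have hp : 0 < E.price := div_pos (Nat.cast_pos.2 hE.2.2.2) (Nat.cast_pos.2 hk)
  have hT : 0 < tr.time (E.k - 1) := tr.time_pos hp hk _
  have hne {c : ℕ} (hc : c ∉ (Finset.range E.k).image tr.elected) :
      ∀ j < E.k, tr.elected j ≠ c := fun j hj h =>
    hc (Finset.mem_image.2 ⟨j, Finset.mem_range.2 hj, h⟩)
  refine ⟨fun c hc => ?_, fun c hc => ?_, fun c hcC hc => ?_⟩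
  · obtain ⟨j, hj, rfl⟩ := Finset.mem_image.1 hc
    simp only [priceSystem]
    rw [← Finset.sum_div, tr.sum_spentOn_elected (Finset.mem_range.1 hj)]
  · simp [priceSystem, tr.spentOn_eq_zero_of_not_elected (hne hc)]
  · have hspent (i : ℕ) := tr.sum_spentOn (S := (Finset.range E.k).image tr.elected)
      (fun j hj => Finset.mem_image_of_mem _ (Finset.mem_range.2 hj)) i
    simp only [priceSystem, ← Finset.sum_div, hspent]
    rw [le_div_iff₀ hT, Finset.sum_mul]
    refine (Finset.sum_le_sum fun i _ => ?_).trans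
      (tr.first (E.k - 1) (Nat.sub_lt hk one_pos) c hcC
        fun j hj => hne hc j (hj.trans_le (Nat.sub_le _ _)))
    have h := tr.reset_succ_eq_add_spent (E.k - 1) i
    rw [Nat.sub_add_cancel hk] at h
    rw [sub_mul, div_mul_cancel₀ _ hT.ne', one_mul]
    linarith [tr.spent_nonneg i (E.k - 1)]

end PhragmenTrace

/-- Every committee output by Phragmén's sequential rule
(under any tie-breaking) is priceable. -/
theorem phragmen_output_priceable (E : Election) (hE : E.Valid)
    (W : Finset ℕ) (hW : PhragmenOutput E W) :
    Priceable E W := by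
  obtain ⟨tr, rfl⟩ := hW
  exact ⟨tr.priceSystem hE, tr.priceSystem_supportsW hE⟩

end ABC
end

section
/- On every laminar election instance (P,k), every committee output by Rule X (under any tie-breaking) is laminar proportional. -/
/-!
Common framework for approval-based committee elections
(Peters & Skowron, "Proportionality and the Limits of Welfarism").
-/

namespace ABC

/-! ### Rule X with a free price and a free initial budget

Affordability and reachability without the candidate set, with an arbitrary price `p` and a
common initial budget `β`; budgets only matter on the voter set. This form passes to
sub-instances without rescaling. -/

/-- The approvers of `c ∉ W` can raise `p` while each paying at most `q`. -/
def AffordableAt (E : Election) (p : ℝ) (b : ℕ → ℝ) (W : Finset ℕ) (c : ℕ) (q : ℝ) : Prop :=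
  c ∉ W ∧ 0 ≤ q ∧ p ≤ ∑ i ∈ E.approvers c, min q (b i)

/-- Reachable states of Rule X with price `p` and initial budgets `β`. -/
inductive ReachAt (E : Election) (p β : ℝ) : (ℕ → ℝ) → Finset ℕ → Prop
  | init {b : ℕ → ℝ} : (∀ i ∈ E.N, b i = β) → ReachAt E p β b ∅
  | step {b b' : ℕ → ℝ} {W : Finset ℕ} {c : ℕ} {q : ℝ} :
      ReachAt E p β b W →
      AffordableAt E p b W c q →
      (∀ c' q', AffordableAt E p b W c' q' → q ≤ q') →
      (∀ i ∈ E.N, b' i = if c ∈ E.A i then b i - min q (b i) else b i) →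
      ReachAt E p β b' (insert c W)

theorem mem_approvers {E : Election} {c i : ℕ} : i ∈ E.approvers c ↔ i ∈ E.N ∧ c ∈ E.A i := by
  simp [Election.approvers]

theorem mem_CP {E : Election} {c : ℕ} : c ∈ E.CP ↔ ∃ i ∈ E.N, c ∈ E.A i := by
  simp [Election.CP]

theorem approvers_eq_of_forall_mem {E : Election} {c : ℕ} (h : ∀ i ∈ E.N, c ∈ E.A i) :
    E.approvers c = E.N :=
  Finset.filter_true_of_mem h

theorem approvers_eraseCand {E : Election} {c d : ℕ} (h : d ≠ c) :
    (eraseCand E c).approvers d = E.approvers d := by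
  ext i; simp [mem_approvers, eraseCand, h]

theorem AffordableAt.mem_CP {E : Election} {p : ℝ} {b : ℕ → ℝ} {W : Finset ℕ} {c : ℕ} {q : ℝ}
    (hp : 0 < p) (h : AffordableAt E p b W c q) : c ∈ E.CP := by
  by_contra hc
  have : E.approvers c = ∅ := by
    ext i
    simp only [mem_approvers, Finset.notMem_empty, iff_false]
    exact fun hi => hc (ABC.mem_CP.2 ⟨i, hi⟩)
  have h3 := h.2.2
  rw [this, Finset.sum_empty] at h3
  linarith

theorem ReachAt.subset_CP {E : Election} {p β : ℝ} (hp : 0 < p) {b : ℕ → ℝ} {W : Finset ℕ}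
    (h : ReachAt E p β b W) : W ⊆ E.CP := by
  induction h with
  | init _ => simp
  | step _ ha _ _ ih => exact Finset.insert_subset (ha.mem_CP hp) ih

/-- Reachability only depends on the budgets of the voters. -/
theorem ReachAt.congr {E : Election} {p β : ℝ} {b b' : ℕ → ℝ} {W : Finset ℕ}
    (h : ReachAt E p β b W) (hb : ∀ i ∈ E.N, b' i = b i) : ReachAt E p β b' W := by
  cases h with
  | init h0 => exact .init fun i hi => (hb i hi).trans (h0 i hi)
  | step h1 h2 h3 h4 => exact .step h1 h2 h3 fun i hi => (hb i hi).trans (h4 i hi)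

/-- A candidate raising `n * x` from payments of at most `x` is approved by everyone, and
everyone pays exactly `x`. -/
theorem AffordableAt.of_le {E : Election} {x : ℝ} (hx : 0 < x) (hN : E.N.Nonempty)
    {b : ℕ → ℝ} {W : Finset ℕ} {d : ℕ} {q : ℝ}
    (h : AffordableAt E (E.N.card * x) b W d q) (hq : q ≤ x) :
    (∀ i ∈ E.N, d ∈ E.A i) ∧ q = x := by
  have hle : ∀ i ∈ E.N, (if d ∈ E.A i then min q (b i) else 0) ≤ x := by
    intro i _
    split_ifs
    · exact (min_le_left _ _).trans hq
    · exact hx.le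
  have hsum : ∑ i ∈ E.N, (if d ∈ E.A i then min q (b i) else 0) = ∑ _i ∈ E.N, x := by
    refine le_antisymm (Finset.sum_le_sum hle) ?_
    rw [← Finset.sum_filter, Finset.sum_const, nsmul_eq_mul]
    exact h.2.2
  have heq := (Finset.sum_eq_sum_iff_of_le hle).1 hsum
  have hmem : ∀ i ∈ E.N, d ∈ E.A i := by
    intro i hi
    by_contra hd
    have := heq i hi
    rw [if_neg hd] at this
    exact hx.ne this
  refine ⟨hmem, le_antisymm hq ?_⟩
  obtain ⟨i, hi⟩ := hN
  have := heq i hi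
  rw [if_pos (hmem i hi)] at this
  exact this ▸ min_le_left _ _

theorem affordableAt_of_forall_mem {E : Election} {x : ℝ} (hx : 0 < x)
    {b : ℕ → ℝ} {W : Finset ℕ} {d : ℕ} (hd : ∀ i ∈ E.N, d ∈ E.A i) (hW : d ∉ W)
    (hb : ∀ i ∈ E.N, x ≤ b i) : AffordableAt E (E.N.card * x) b W d x := by
  refine ⟨hW, hx.le, ?_⟩
  rw [approvers_eq_of_forall_mem hd, Finset.sum_congr rfl fun i hi => min_eq_left (hb i hi),
    Finset.sum_const, nsmul_eq_mul]

/-! ### Structure of laminar instances -/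

theorem Combines.symm {E E₁ E₂ : Election} (h : Combines E E₁ E₂) : Combines E E₂ E₁ := by
  obtain ⟨h1, h2, h3, h4, h5, h6, h7, h8, h9⟩ := h
  exact ⟨h1.symm, h2.symm, by rw [h3, Finset.union_comm], h5, h4, by omega, h8, h7, h9.symm⟩

theorem Combines.card_mul {E E₁ E₂ : Election} (h : Combines E E₁ E₂) :
    E.N.card * E₁.k = E₁.N.card * E.k := by
  obtain ⟨h1, -, h3, -, -, h6, -, -, h9⟩ := h
  rw [h3, Finset.card_union_of_disjoint h1, h6]
  linarith

theorem Combines.left_nonempty {E E₁ E₂ : Election} (h : Combines E E₁ E₂)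
    (hN : E.N.Nonempty) : E₁.N.Nonempty := by
  have h1 := h.card_mul
  obtain ⟨-, -, -, -, -, -, h7, -, -⟩ := h
  have h2 : 0 < E.N.card * E₁.k := Nat.mul_pos hN.card_pos h7
  rw [h1] at h2
  exact Finset.card_pos.1 (Nat.pos_of_mul_pos_right h2)

/-- In a laminar instance that is not unanimous, fewer than `k` candidates are approved by
every voter. -/
theorem Laminar.card_lt {E : Election} (hL : Laminar E) (hN : E.N.Nonempty)
    (hU : ¬ Unanimous E) {W : Finset ℕ} (hW : ∀ d ∈ W, ∀ i ∈ E.N, d ∈ E.A i) :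
    W.card < E.k := by
  induction hL generalizing W with
  | unanimous E h _ => exact absurd h hU
  | consensus E c hk _ _ hnu _ ih =>
    have h1 : (W.erase c).card < E.k - 1 := by
      refine ih hN hnu fun d hd i hi => ?_
      obtain ⟨hdc, hdW⟩ := Finset.mem_erase.1 hd
      exact Finset.mem_erase.2 ⟨hdc, hW d hdW i hi⟩
    have h2 := Finset.pred_card_le_card_erase (s := W) (a := c)
    omega
  | combine E E₁ E₂ hc _ _ _ _ =>
    obtain ⟨i, hi⟩ := hc.left_nonempty hN
    obtain ⟨j, hj⟩ := hc.symm.left_nonempty hN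
    obtain ⟨-, h2, h3, h4, h5, h6, h7, -, -⟩ := hc
    have : W = ∅ := by
      refine Finset.eq_empty_of_forall_notMem fun d hd => ?_
      have hdi : d ∈ E₁.A i := h4 i hi ▸ hW d hd i (h3 ▸ Finset.mem_union_left _ hi)
      have hdj : d ∈ E₂.A j := h5 j hj ▸ hW d hd j (h3 ▸ Finset.mem_union_right _ hj)
      exact Finset.disjoint_left.1 h2 (mem_CP.2 ⟨i, hi, hdi⟩) (mem_CP.2 ⟨j, hj, hdj⟩)
    rw [this, Finset.card_empty]
    omega

/-! ### Unanimous profiles -/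

theorem ReachAt.unanimous_invariant {E : Election} {x : ℝ} (hx : 0 < x) (hN : E.N.Nonempty)
    (hU : Unanimous E) {b : ℕ → ℝ} {W : Finset ℕ}
    (h : ReachAt E (E.N.card * x) (E.k * x) b W) :
    W.card ≤ E.k ∧ ∀ i ∈ E.N, b i = (E.k - W.card) * x := by
  have hn : (0 : ℝ) < E.N.card := by exact_mod_cast hN.card_pos
  induction h with
  | init h0 => exact ⟨by simp, fun i hi => by simp [h0 i hi]⟩
  | @step b b' W c q _ ha hmin hb' ih =>
    obtain ⟨hcard, hb⟩ := ih
    obtain ⟨j, hj, hcj⟩ := mem_CP.1 (ha.mem_CP (mul_pos hn hx))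
    have hc : ∀ i ∈ E.N, c ∈ E.A i := fun i hi => hU j hj i hi ▸ hcj
    have hxb : x ≤ (E.k - W.card) * x := by
      have h3 := ha.2.2
      rw [approvers_eq_of_forall_mem hc,
        Finset.sum_congr rfl fun i hi => congrArg (min q) (hb i hi), Finset.sum_const,
        nsmul_eq_mul] at h3
      exact (le_of_mul_le_mul_left h3 hn).trans (min_le_right _ _)
    have hq : q = x := (ha.of_le hx hN (hmin c x
      (affordableAt_of_forall_mem hx hc ha.1 fun i hi => (hb i hi).symm ▸ hxb))).2
    rw [Finset.card_insert_of_notMem ha.1]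
    constructor
    · have h1 : (1 : ℝ) ≤ E.k - W.card := le_of_mul_le_mul_right (by linarith) hx
      have h2 : (W.card : ℝ) + 1 ≤ E.k := by linarith
      exact_mod_cast h2
    · intro i hi
      rw [hb' i hi, if_pos (hc i hi), hb i hi, hq, min_eq_left hxb]
      push_cast
      ring

theorem ReachAt.card_eq_of_unanimous {E : Election} {x : ℝ} (hx : 0 < x) (hN : E.N.Nonempty)
    (hU : Unanimous E) (hk : E.k ≤ E.CP.card) {b : ℕ → ℝ} {W : Finset ℕ}
    (h : ReachAt E (E.N.card * x) (E.k * x) b W)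
    (hend : ∀ c q, ¬ AffordableAt E (E.N.card * x) b W c q) : W.card = E.k := by
  obtain ⟨hcard, hb⟩ := h.unanimous_invariant hx hN hU
  refine hcard.antisymm (not_lt.1 fun hlt => ?_)
  obtain ⟨c, hc, hcW⟩ := Finset.exists_mem_notMem_of_card_lt_card (hlt.trans_le hk)
  obtain ⟨j, hj, hcj⟩ := mem_CP.1 hc
  refine hend c x (affordableAt_of_forall_mem hx (fun i hi => hU j hj i hi ▸ hcj) hcW ?_)
  intro i hi
  have h1 : (W.card : ℝ) + 1 ≤ E.k := by exact_mod_cast hlt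
  rw [hb i hi]
  nlinarith

/-! ### Removing a unanimously approved candidate -/

theorem affordableAt_eraseCand_iff {E : Election} {p : ℝ} (hp : 0 < p) {b : ℕ → ℝ}
    {W : Finset ℕ} {c d : ℕ} {q : ℝ} (hcW : c ∈ W) :
    AffordableAt (eraseCand E c) p b (W.erase c) d q ↔ AffordableAt E p b W d q := by
  constructor
  · intro h
    have hdc : d ≠ c := by
      rintro rfl
      obtain ⟨i, _, hi⟩ := mem_CP.1 (h.mem_CP hp)
      simp [eraseCand] at hi
    obtain ⟨h1, h2, h3⟩ := h
    rw [approvers_eraseCand hdc] at h3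
    exact ⟨fun hd => h1 (Finset.mem_erase.2 ⟨hdc, hd⟩), h2, h3⟩
  · rintro ⟨h1, h2, h3⟩
    have hdc : d ≠ c := fun h => h1 (h ▸ hcW)
    exact ⟨fun hd => h1 (Finset.mem_of_mem_erase hd), h2, by rwa [approvers_eraseCand hdc]⟩

/-- A run of Rule X on an instance with a unanimously approved candidate `c` induces a run on
the instance without `c`, whether or not `c` has been elected yet. -/
theorem ReachAt.eraseCand_invariant {E : Election} {x : ℝ} (hx : 0 < x) (hN : E.N.Nonempty)
    {c : ℕ} (hc : ∀ i ∈ E.N, c ∈ E.A i) (hU : ¬ Unanimous (eraseCand E c))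
    (hL : Laminar (eraseCand E c)) {b : ℕ → ℝ} {W : Finset ℕ}
    (h : ReachAt E (E.N.card * x) (E.k * x) b W) :
    (c ∈ W ∧ ReachAt (eraseCand E c) (E.N.card * x) ((E.k - 1) * x) b (W.erase c)) ∨
    (c ∉ W ∧ ReachAt (eraseCand E c) (E.N.card * x) ((E.k - 1) * x) (fun i => b i - x) W ∧
      (∀ d ∈ W, ∀ i ∈ E.N, d ∈ E.A i) ∧ ∀ i ∈ E.N, b i = (E.k - W.card) * x ∧ 2 * x ≤ b i) := by
  have hn : (0 : ℝ) < E.N.card := by exact_mod_cast hN.card_pos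
  have hbound : ∀ V : Finset ℕ, c ∉ V → (∀ d ∈ V, ∀ i ∈ E.N, d ∈ E.A i) →
      2 * x ≤ (E.k - V.card) * x := by
    intro V hcV hV
    have h1 : V.card < E.k - 1 := hL.card_lt hN hU fun d hd i hi =>
      Finset.mem_erase.2 ⟨fun h => hcV (h ▸ hd), hV d hd i hi⟩
    have h2 : (V.card : ℝ) + 2 ≤ E.k := by exact_mod_cast (by omega : V.card + 2 ≤ E.k)
    nlinarith
  induction h with
  | init h0 =>
    refine Or.inr ⟨by simp, .init fun i hi => ?_, by simp, fun i hi => ?_⟩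
    · rw [h0 i hi]; ring
    · have := hbound ∅ (by simp) (by simp)
      rw [h0 i hi]
      simp only [Finset.card_empty, Nat.cast_zero, sub_zero] at this ⊢
      exact ⟨trivial, this⟩
  | @step b b' W d q _ ha hmin hb' ih =>
    rcases ih with ⟨hcW, hr⟩ | ⟨hcW, hr, hW, hb⟩
    · have hdc : d ≠ c := fun h => ha.1 (h ▸ hcW)
      refine Or.inl ⟨Finset.mem_insert_of_mem hcW, ?_⟩
      rw [Finset.erase_insert_of_ne hdc]
      have hp := mul_pos hn hx
      refine hr.step ((affordableAt_eraseCand_iff hp hcW).2 ha)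
        (fun d' q' h' => hmin d' q' ((affordableAt_eraseCand_iff hp hcW).1 h')) fun i hi => ?_
      rw [hb' i hi]
      simp [eraseCand, hdc]
    · have hxb : ∀ i ∈ E.N, x ≤ b i := fun i hi => by linarith [(hb i hi).2]
      obtain ⟨hd, rfl⟩ := ha.of_le hx hN
        (hmin c x (affordableAt_of_forall_mem hx hc hcW hxb))
      have hb'' : ∀ i ∈ E.N, b' i = b i - q := fun i hi => by
        rw [hb' i hi, if_pos (hd i hi), min_eq_left (hxb i hi)]
      by_cases hdc : d = c
      · subst hdc
        refine Or.inl ⟨Finset.mem_insert_self _ _, ?_⟩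
        rw [Finset.erase_insert hcW]
        exact hr.congr hb''
      · have hcW' : c ∉ insert d W := by
          simp [hcW, Ne.symm hdc]
        have hW' : ∀ e ∈ insert d W, ∀ i ∈ E.N, e ∈ E.A i :=
          Finset.forall_mem_insert _ _ _ |>.2 ⟨hd, hW⟩
        have hd' : ∀ i ∈ (eraseCand E c).N, d ∈ (eraseCand E c).A i := fun i hi =>
          Finset.mem_erase.2 ⟨hdc, hd i hi⟩
        have hxb' : ∀ i ∈ (eraseCand E c).N, q ≤ b i - q := fun i hi => by
          linarith [(hb i hi).2]
        refine Or.inr ⟨hcW', ?_, hW', fun i hi => ?_⟩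
        · refine hr.step (affordableAt_of_forall_mem hx hd' ha.1 hxb') ?_ fun i hi => ?_
          · intro d' q' h'
            refine le_of_not_gt fun hlt => ?_
            exact hlt.ne (AffordableAt.of_le (E := eraseCand E c) hx hN h' hlt.le).2
          · rw [if_pos (hd' i hi), min_eq_left (hxb' i hi), hb'' i hi]
        · have h1 : b' i = (E.k - (insert d W).card) * q := by
            rw [hb'' i hi, (hb i hi).1, Finset.card_insert_of_notMem ha.1]
            push_cast
            ring
          exact ⟨h1, h1 ▸ hbound _ hcW' hW'⟩

/-! ### Concatenations -/

theorem Combines.approvers_left {E E₁ E₂ : Election} (h : Combines E E₁ E₂) {c : ℕ}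
    (hc : c ∈ E₁.CP) : E.approvers c = E₁.approvers c := by
  obtain ⟨-, h2, h3, h4, h5, -⟩ := h
  ext i
  simp only [mem_approvers, h3, Finset.mem_union]
  constructor
  · rintro ⟨hi | hi, hci⟩
    · exact ⟨hi, h4 i hi ▸ hci⟩
    · exact absurd (mem_CP.2 ⟨i, hi, h5 i hi ▸ hci⟩) (Finset.disjoint_left.1 h2 hc)
  · rintro ⟨hi, hci⟩
    exact ⟨Or.inl hi, (h4 i hi).symm ▸ hci⟩

theorem Combines.CP_eq {E E₁ E₂ : Election} (h : Combines E E₁ E₂) :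
    E.CP = E₁.CP ∪ E₂.CP := by
  obtain ⟨-, -, h3, h4, h5, -⟩ := h
  rw [Election.CP, h3, Finset.union_biUnion, Finset.biUnion_congr rfl h4,
    Finset.biUnion_congr rfl h5]
  rfl

theorem Combines.affordableAt_of_left {E E₁ E₂ : Election} (h : Combines E E₁ E₂) {p : ℝ}
    (hp : 0 < p) {b : ℕ → ℝ} {W : Finset ℕ} {c : ℕ} {q : ℝ}
    (ha : AffordableAt E₁ p b (W ∩ E₁.CP) c q) : AffordableAt E p b W c q := by
  have hc := ha.mem_CP hp
  obtain ⟨h1, h2, h3⟩ := ha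
  exact ⟨fun hW => h1 (Finset.mem_inter.2 ⟨hW, hc⟩), h2, by rwa [h.approvers_left hc]⟩

theorem Combines.reachAt_left {E E₁ E₂ : Election} (h : Combines E E₁ E₂) {p β : ℝ}
    (hp : 0 < p) {b : ℕ → ℝ} {W : Finset ℕ} (hr : ReachAt E p β b W) :
    ReachAt E₁ p β b (W ∩ E₁.CP) := by
  have hN : ∀ i ∈ E₁.N, i ∈ E.N := fun i hi => h.2.2.1 ▸ Finset.mem_union_left _ hi
  have hA : ∀ i ∈ E₁.N, E.A i = E₁.A i := h.2.2.2.1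
  induction hr with
  | init h0 =>
    rw [Finset.empty_inter]
    exact .init fun i hi => h0 i (hN i hi)
  | @step b b' W c q _ ha hmin hb' ih =>
    by_cases hc : c ∈ E₁.CP
    · rw [Finset.insert_inter_of_mem hc]
      refine ih.step ⟨fun hW => ha.1 (Finset.mem_inter.1 hW).1, ha.2.1, ?_⟩
        (fun c' q' h' => hmin c' q' (h.affordableAt_of_left hp h')) fun i hi => ?_
      · rw [← h.approvers_left hc]
        exact ha.2.2
      · rw [hb' i (hN i hi), hA i hi]
    · rw [Finset.insert_inter_of_notMem hc]
      refine ih.congr fun i hi => ?_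
      rw [hb' i (hN i hi), hA i hi, if_neg fun hci => hc (mem_CP.2 ⟨i, hi, hci⟩)]

/-! ### The main induction -/

theorem Laminar.lamProp_of_reachAt {E : Election} (hL : Laminar E) (hN : E.N.Nonempty)
    (hk : 0 < E.k) {p β : ℝ} (hβ : 0 < β) (hp : p * E.k = E.N.card * β) {b : ℕ → ℝ}
    {W : Finset ℕ} (hr : ReachAt E p β b W) (hend : ∀ c q, ¬ AffordableAt E p b W c q) :
    LamProp E W := by
  induction hL generalizing p β b W with
  | unanimous E hU hCP =>
    have hk' : (0 : ℝ) < E.k := by exact_mod_cast hk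
    have hn : (0 : ℝ) < E.N.card := by exact_mod_cast hN.card_pos
    obtain ⟨x, rfl⟩ : ∃ x, β = E.k * x := ⟨β / E.k, by field_simp⟩
    have hx : 0 < x := pos_of_mul_pos_right hβ hk'.le
    obtain rfl : p = E.N.card * x := mul_right_cancel₀ hk'.ne' (by rw [hp]; ring)
    exact .unanimous E W hU (hr.subset_CP (mul_pos hn hx))
      (hr.card_eq_of_unanimous hx hN hU hCP hend)
  | consensus E c _ hc hcN hU hL ih =>
    have hk' : (0 : ℝ) < E.k := by exact_mod_cast hk
    have hn : (0 : ℝ) < E.N.card := by exact_mod_cast hN.card_pos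
    obtain ⟨x, rfl⟩ : ∃ x, β = E.k * x := ⟨β / E.k, by field_simp⟩
    have hx : 0 < x := pos_of_mul_pos_right hβ hk'.le
    obtain rfl : p = E.N.card * x := mul_right_cancel₀ hk'.ne' (by rw [hp]; ring)
    have hk1 : 0 < E.k - 1 := (Nat.zero_le _).trans_lt (hL.card_lt hN hU (W := ∅) (by simp))
    have hk2 : ((E.k - 1 : ℕ) : ℝ) = E.k - 1 := by
      rw [Nat.cast_sub hk, Nat.cast_one]
    rcases hr.eraseCand_invariant hx hN hcN hU hL with ⟨hcW, hr'⟩ | ⟨hcW, -, -, hb⟩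
    · rw [← Finset.insert_erase hcW]
      refine .consensus E c _ hk hc hcN hL ?_ (Finset.notMem_erase _ _)
      refine ih hN hk1 ?_ ?_ hr' fun d q h =>
        hend d q ((affordableAt_eraseCand_iff (mul_pos hn hx) hcW).1 h)
      · rw [← hk2]
        exact mul_pos (by exact_mod_cast hk1) hx
      · change (E.N.card : ℝ) * x * ((E.k - 1 : ℕ) : ℝ) = E.N.card * ((E.k - 1) * x)
        rw [hk2]
        ring
    · exact absurd (affordableAt_of_forall_mem hx hcN hcW fun i hi => by
        linarith [(hb i hi).2]) (hend c x)
  | combine E E₁ E₂ hc _ _ ih₁ ih₂ =>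
    have hk' : (0 : ℝ) < E.k := by exact_mod_cast hk
    have hn : (0 : ℝ) < E.N.card := by exact_mod_cast hN.card_pos
    have hp0 : 0 < p := pos_of_mul_pos_left (hp ▸ mul_pos hn hβ) hk'.le
    have price : ∀ {F G : Election}, Combines E F G → p * F.k = F.N.card * β := by
      intro F G h
      have h1 : (E.N.card : ℝ) * F.k = F.N.card * E.k := by exact_mod_cast h.card_mul
      refine mul_right_cancel₀ hk'.ne' ?_
      linear_combination (F.k : ℝ) * hp + β * h1
    have hW : W = W ∩ E₁.CP ∪ W ∩ E₂.CP := by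
      rw [← Finset.inter_union_distrib_left, ← hc.CP_eq,
        Finset.inter_eq_left.2 (hr.subset_CP hp0)]
    rw [hW]
    refine .combine E E₁ E₂ _ _ hc ?_ ?_
    · exact ih₁ (hc.left_nonempty hN) hc.2.2.2.2.2.2.1 hβ (price hc) (hc.reachAt_left hp0 hr)
        fun d q h => hend d q (hc.affordableAt_of_left hp0 h)
    · exact ih₂ (hc.symm.left_nonempty hN) hc.symm.2.2.2.2.2.2.1 hβ (price hc.symm)
        (hc.symm.reachAt_left hp0 hr) fun d q h => hend d q (hc.symm.affordableAt_of_left hp0 h)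

theorem Election.Valid.price_pos {E : Election} (hE : E.Valid) : 0 < E.price :=
  div_pos (by exact_mod_cast hE.2.2.2) (by exact_mod_cast hE.2.2.1)

theorem Election.Valid.affordable_iff {E : Election} (hE : E.Valid) {b : ℕ → ℝ} {W : Finset ℕ}
    {c : ℕ} {q : ℝ} : Affordable E b W c q ↔ AffordableAt E E.price b W c q := by
  refine ⟨fun h => h.2, fun h => ⟨?_, h⟩⟩
  obtain ⟨i, hi, hci⟩ := mem_CP.1 (h.mem_CP hE.price_pos)
  exact hE.1 i hi hci

theorem RuleXReach.reachAt {E : Election} (hE : E.Valid) {b : ℕ → ℝ} {W : Finset ℕ}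
    (h : RuleXReach E b W) : ReachAt E E.price 1 b W := by
  induction h with
  | init => exact .init fun _ _ => rfl
  | step _ ha hmin ih =>
    refine ih.step (hE.affordable_iff.1 ha) (fun c' q' h' => hmin c' q' (hE.affordable_iff.2 h'))
      fun i hi => ?_
    simp [mem_approvers, hi]

/-- On every laminar instance, every committee output by Rule X
(under any tie-breaking) is laminar proportional. -/
theorem ruleX_laminar_proportional (E : Election) (hE : E.Valid) (hL : Laminar E)
    (W : Finset ℕ) (hW : RuleXOutput E W) :
    LamProp E W := by
  obtain ⟨b, hr, hend⟩ := hW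
  have hk : (E.k : ℝ) ≠ 0 := by exact_mod_cast hE.2.2.1.ne'
  refine hL.lamProp_of_reachAt (Finset.card_pos.1 hE.2.2.2) hE.2.2.1 one_pos ?_
    (hr.reachAt hE) fun c q h => hend c q (hE.affordable_iff.2 h)
  rw [Election.price, div_mul_cancel₀ _ hk, mul_one]

end ABC
end

section
/- PAV fails laminar proportionality: there exists a laminar election instance (P,k) and a committee W of size k that maximizes the PAV score among all committees of size at most k, yet W is not laminar proportional for (P,k). -/
/-!
Common framework for approval-based committee elections
(Peters & Skowron, "Proportionality and the Limits of Welfarism").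
-/

namespace ABC

/-- A laminar proportional committee consists of `k` approved candidates. -/
theorem LamProp.subset_CP_and_card {E : Election} {W : Finset ℕ} (h : LamProp E W) :
    W ⊆ E.CP ∧ W.card = E.k := by
  induction h with
  | unanimous E W _ hW hk => exact ⟨hW, hk⟩
  | consensus E c W' hk hc _ _ _ hcW ih =>
    obtain ⟨hsub, hcard⟩ := ih
    refine ⟨Finset.insert_subset hc fun x hx => ?_, ?_⟩
    · obtain ⟨i, hi, hxi⟩ := Finset.mem_biUnion.1 (hsub hx)
      exact Finset.mem_biUnion.2 ⟨i, hi, Finset.mem_of_mem_erase hxi⟩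
    · rw [Finset.card_insert_of_notMem hcW, hcard]
      exact Nat.sub_add_cancel hk
  | combine E E₁ E₂ W₁ W₂ h _ _ ih₁ ih₂ =>
    refine ⟨h.CP_eq ▸ Finset.union_subset_union ih₁.1 ih₂.1, ?_⟩
    rw [Finset.card_union_of_disjoint (Disjoint.mono ih₁.1 ih₂.1 h.2.1), ih₁.2, ih₂.2]
    exact h.2.2.2.2.2.1.symm

/-- In a concatenation, two voters with a common approved candidate are on the same side. -/
theorem Combines.mem_left_of_common {E E₁ E₂ : Election} (h : Combines E E₁ E₂) {i j c : ℕ}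
    (hi : i ∈ E₁.N) (hj : j ∈ E.N) (hci : c ∈ E.A i) (hcj : c ∈ E.A j) : j ∈ E₁.N := by
  obtain ⟨-, hC, hu, h₁, h₂, -⟩ := h
  rw [hu, Finset.mem_union] at hj
  refine hj.resolve_right fun hj₂ => Finset.disjoint_left.1 hC
    (Finset.mem_biUnion.2 ⟨i, hi, h₁ i hi ▸ hci⟩) (Finset.mem_biUnion.2 ⟨j, hj₂, h₂ j hj₂ ▸ hcj⟩)

/-- The ballots `{0, 1}`, `{0, 2}`, `{3, 4, 5, 6}`, `{3, 4, 5, 6}` of voters `0`, `1`, `2`, `3`. -/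
def twoBlockBallot : ℕ → Finset ℕ
  | 0 => {0, 1}
  | 1 => {0, 2}
  | _ => {3, 4, 5, 6}

/-- Two blocks of two voters each: one agrees on a single candidate, the other is unanimous.
PAV favours the unanimous block. -/
def twoBlock : Election where
  C := Finset.range 7
  N := Finset.range 4
  A := twoBlockBallot
  k := 6

theorem laminar_twoBlock : Laminar twoBlock := by
  let E₁ : Election := ⟨{0, 1, 2}, {0, 1}, twoBlockBallot, 3⟩
  let E₂ : Election := ⟨{3, 4, 5, 6}, {2, 3}, twoBlockBallot, 3⟩
  let F : ℕ → Election := fun i => ⟨{i + 1}, {i}, fun j => {j + 1}, 1⟩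
  have hF (i : ℕ) : Laminar (F i) := by
    refine .unanimous _ ?_ ?_
    · simp [F, Unanimous]
    · simp [F, Election.CP]
  refine .combine _ E₁ E₂ ?_ ?_ ?_
  · refine ⟨by decide, by decide, by decide, fun _ _ => rfl, fun _ _ => rfl, rfl, ?_, ?_, rfl⟩ <;>
      decide
  · refine .consensus _ 0 (by decide) (by decide) (by decide) ?_ ?_
    · unfold Unanimous; decide
    · refine .combine _ (F 0) (F 1) ?_ (hF 0) (hF 1)
      refine ⟨?_, ?_, ?_, ?_, ?_, ?_, ?_, ?_, ?_⟩ <;> decide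
  · exact .unanimous _ (by unfold Unanimous; decide) (by decide)

theorem not_lamProp_twoBlock : ¬ LamProp twoBlock {0, 2, 3, 4, 5, 6} := by
  -- The side containing voter `0` gets three seats, but only candidates `0` and `2` are available.
  have key {E₁ E₂ : Election} {W₁ W₂ : Finset ℕ} (h : Combines twoBlock E₁ E₂)
      (h₁ : LamProp E₁ W₁) (hW : W₁ ∪ W₂ = {0, 2, 3, 4, 5, 6}) (h0 : 0 ∈ E₁.N) : False := by
    have h1 : 1 ∈ E₁.N := h.mem_left_of_common (c := 0) h0 (by decide) (by decide) (by decide)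
    obtain ⟨hsub, hcard⟩ := h₁.subset_CP_and_card
    obtain ⟨hN, -, hu, hA, -, hk, -, hk₂, hp⟩ := id h
    have hcardN : E₁.N.card + E₂.N.card = 4 := by
      rw [← Finset.card_union_of_disjoint hN, ← hu]; rfl
    have h2 : 2 ∉ E₁.N := by
      intro h2
      have h3 : 3 ∈ E₁.N :=
        h.mem_left_of_common (c := 3) h2 (by decide) (by decide) (by decide)
      have : ({0, 1, 2, 3} : Finset ℕ) ⊆ E₁.N := by
        simp [Finset.insert_subset_iff, h0, h1, h2, h3]
      have hle := Finset.card_le_card this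
      have h4 : E₁.N.card = 4 := by simp at hle; omega
      have h5 : E₂.N.card = 0 := by omega
      rw [h4, h5] at hp
      omega
    have h3 : 3 ∉ E₁.N := fun h3 =>
      h2 (h.mem_left_of_common (c := 3) h3 (by decide) (by decide) (by decide))
    have hN₁ : E₁.N = {0, 1} := by
      have hle : E₁.N ⊆ Finset.range 4 := by
        change E₁.N ⊆ twoBlock.N
        rw [hu]; exact Finset.subset_union_left
      ext i
      have := @hle i
      simp only [Finset.mem_range] at this
      simp only [Finset.mem_insert, Finset.mem_singleton]
      constructor
      · intro hi
        have := this hi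
        interval_cases i <;> simp_all
      · rintro (rfl | rfl) <;> assumption
    have hk₁ : E₁.k = 3 := by
      have : E₁.N.card = 2 := by rw [hN₁]; rfl
      have hk' : 6 = E₁.k + E₂.k := hk
      have h6 : E₂.N.card = 2 := by omega
      rw [this, h6] at hp
      omega
    have hCP : E₁.CP = {0, 1, 2} := by
      rw [Election.CP, ← Finset.biUnion_congr rfl hA, hN₁]
      decide
    have hW₁ : W₁ ⊆ {0, 1, 2} ∩ {0, 2, 3, 4, 5, 6} :=
      Finset.subset_inter (hCP ▸ hsub) (hW ▸ Finset.subset_union_left)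
    have hle := Finset.card_le_card hW₁
    rw [hcard, hk₁] at hle
    exact absurd hle (by decide)
  intro h
  generalize hE : twoBlock = E at h
  generalize hW : ({0, 2, 3, 4, 5, 6} : Finset ℕ) = W at h
  cases h with
  | unanimous _ _ hu => subst hE; revert hu; unfold Unanimous; decide
  | consensus _ c _ _ _ hc =>
    subst hE
    have h0 := hc 0 (by decide)
    have h2 := hc 2 (by decide)
    simp [twoBlock, twoBlockBallot] at h0 h2
    omega
  | combine _ E₁ E₂ W₁ W₂ h h₁ h₂ =>
    subst hE
    have h0 : 0 ∈ E₁.N ∪ E₂.N := h.2.2.1 ▸ (by decide : 0 ∈ twoBlock.N)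
    rcases Finset.mem_union.1 h0 with h0 | h0
    · exact key h h₁ hW.symm h0
    · exact key h.symm h₂ (by rw [Finset.union_comm, hW]) h0

/-- Twelve times the harmonic number, for arguments up to `4`. -/
def twelveHarmonic : ℕ → ℕ
  | 0 => 0
  | 1 => 12
  | 2 => 18
  | 3 => 22
  | _ => 25

theorem hsum_eq_twelveHarmonic {t : ℕ} (ht : t ≤ 4) : hsum t = (twelveHarmonic t : ℝ) / 12 := by
  interval_cases t <;> norm_num [hsum, Finset.sum_range_succ, twelveHarmonic]

theorem pavScore_twoBlock (W : Finset ℕ) :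
    pavScore twoBlock W =
      ((∑ i ∈ Finset.range 4, twelveHarmonic (twoBlockBallot i ∩ W).card : ℕ) : ℝ) / 12 := by
  rw [Nat.cast_sum, Finset.sum_div]
  refine Finset.sum_congr rfl fun i hi => hsum_eq_twelveHarmonic ?_
  have hcard : ∀ i ∈ Finset.range 4, (twoBlockBallot i).card ≤ 4 := by decide
  exact (Finset.card_le_card Finset.inter_subset_left).trans (hcard i hi)

theorem pavScore_twoBlock_le {W : Finset ℕ} (hW : W ⊆ twoBlock.C) (hk : W.card ≤ twoBlock.k) :
    pavScore twoBlock W ≤ pavScore twoBlock {0, 2, 3, 4, 5, 6} := by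
  have hmax : ∀ V ∈ (Finset.range 7).powerset, V.card ≤ 6 →
      ∑ i ∈ Finset.range 4, twelveHarmonic (twoBlockBallot i ∩ V).card ≤
        ∑ i ∈ Finset.range 4, twelveHarmonic (twoBlockBallot i ∩ {0, 2, 3, 4, 5, 6}).card := by
    decide +kernel
  rw [pavScore_twoBlock, pavScore_twoBlock]
  exact div_le_div_of_nonneg_right
    (Nat.cast_le.2 (hmax W (Finset.mem_powerset.2 hW) hk)) (by norm_num)

/-- PAV fails laminar proportionality: there is a laminar instance
and a committee `W` of size `k` maximizing the PAV score among all committees of size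
at most `k` which is not laminar proportional. -/
theorem pav_fails_laminar_proportionality :
    ∃ (E : Election) (W : Finset ℕ), E.Valid ∧ Laminar E ∧
      W ⊆ E.C ∧ W.card = E.k ∧
      (∀ W' : Finset ℕ, W' ⊆ E.C → W'.card ≤ E.k → pavScore E W' ≤ pavScore E W) ∧
      ¬ LamProp E W := by
  refine ⟨twoBlock, {0, 2, 3, 4, 5, 6}, ⟨?_, ?_, ?_, ?_⟩, laminar_twoBlock, ?_, rfl,
    fun _ hW hk => pavScore_twoBlock_le hW hk, not_lamProp_twoBlock⟩ <;> decide

end ABC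
end

section
/- For every ε > 0, there exists no committee rule that satisfies the Pigou–Dalton principle and whose every output committee is in the (2−ε)-core of the given instance. -/
/-!
Common framework for approval-based committee elections
(Peters & Skowron, "Proportionality and the Limits of Welfarism").
-/

namespace ABC

/-- Swapping an elected candidate `a` approved only by `j` for an unelected candidate `b`
approved only by `i` is a Pigou–Dalton transfer when `j` is at least two better off than `i`. -/
theorem admitsPD_of_swap {E : Election} {W : Finset ℕ} {i j a b : ℕ} (hW : W ⊆ E.C)
    (hi : i ∈ E.N) (hj : j ∈ E.N) (hbC : b ∈ E.C) (haW : a ∈ W) (hbW : b ∉ W)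
    (ha : ∀ l ∈ E.N, a ∈ E.A l ↔ l = j) (hb : ∀ l ∈ E.N, b ∈ E.A l ↔ l = i)
    (hlt : (E.A i ∩ W).card + 1 < (E.A j ∩ W).card) : AdmitsPD E W := by
  have hij : i ≠ j := by
    rintro rfl
    omega
  have hba : b ≠ a := fun h => hbW (h ▸ haW)
  have hother : ∀ l ∈ E.N, l ≠ i → l ≠ j →
      E.A l ∩ insert b (W.erase a) = E.A l ∩ W := by
    intro l hl hli hlj
    have hal := mt (ha l hl).1 hlj
    have hbl := mt (hb l hl).1 hli
    grind
  have hAi : (E.A i ∩ insert b (W.erase a)).card = (E.A i ∩ W).card + 1 := by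
    have hai := mt (ha i hi).1 hij
    have hbi := (hb i hi).2 rfl
    have hset : E.A i ∩ insert b (W.erase a) = insert b (E.A i ∩ W) := by grind
    rw [hset, Finset.card_insert_of_notMem (by simp [hbW])]
  have hAj : (E.A j ∩ insert b (W.erase a)).card + 1 = (E.A j ∩ W).card := by
    have haj := (ha j hj).2 rfl
    have hbj := mt (hb j hj).1 hij.symm
    have hset : E.A j ∩ insert b (W.erase a) = (E.A j ∩ W).erase a := by grind
    rw [hset, Finset.card_erase_add_one (Finset.mem_inter.2 ⟨haj, haW⟩)]
  refine ⟨insert b (W.erase a), ?_, ?_, i, hi, j, hj, hij, by omega,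
    fun l hl hli hlj => by rw [hother l hl hli hlj], by omega, by omega, by omega, by omega⟩
  · exact Finset.insert_subset hbC ((Finset.erase_subset _ _).trans hW)
  · rw [Finset.card_insert_of_notMem (by simp [hbW]), Finset.card_erase_add_one haW]

/-- The `i`-th of the consecutive blocks of `k` candidates that follow the first `m` ones. -/
def block (m k i : ℕ) : Finset ℕ := Finset.Ico (m + i * k) (m + i * k + k)

theorem card_block (m k i : ℕ) : (block m k i).card = k := by simp [block]

theorem le_of_mem_block {m k i c : ℕ} (h : c ∈ block m k i) : m ≤ c := by
  simp only [block, Finset.mem_Ico] at h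
  omega

theorem eq_of_mem_block {m k i j c : ℕ} (hi : c ∈ block m k i) (hj : c ∈ block m k j) :
    i = j := by
  simp only [block, Finset.mem_Ico] at hi hj
  by_contra hne
  rcases Nat.lt_or_gt_of_ne hne with h | h
  · have := Nat.mul_le_mul_right k (Nat.succ_le_of_lt h)
    rw [Nat.succ_mul] at this
    omega
  · have := Nat.mul_le_mul_right k (Nat.succ_le_of_lt h)
    rw [Nat.succ_mul] at this
    omega

theorem block_subset_range {m k i n : ℕ} (hi : i < n) :
    block m k i ⊆ Finset.range (m + n * k) := by
  intro c hc
  simp only [block, Finset.mem_Ico] at hc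
  have := Nat.mul_le_mul_right k (Nat.succ_le_of_lt hi)
  rw [Nat.succ_mul] at this
  rw [Finset.mem_range]
  omega

/-- There are `n` voters, each with a private block of `k` candidates; the first `m` voters
moreover all approve the `m` common candidates `0, …, m - 1`. -/
def commonPrivate (m n k : ℕ) : Election where
  C := Finset.range (m + n * k)
  N := Finset.range n
  A i := block m k i ∪ if i < m then Finset.range m else ∅
  k := k

theorem commonPrivate_valid {m n k : ℕ} (hn : 0 < n) (hk : 0 < k) :
    (commonPrivate m n k).Valid := by
  refine ⟨fun i hi => ?_, ?_, hk, by simpa [commonPrivate] using hn⟩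
  · refine Finset.union_subset (block_subset_range (Finset.mem_range.1 hi)) ?_
    split_ifs
    · exact Finset.range_subset_range.2 (Nat.le_add_right _ _)
    · exact Finset.empty_subset _
  · simp only [commonPrivate, Finset.card_range]
    nlinarith

theorem mem_ballot_iff_of_mem_block {m n k i l c : ℕ} (hc : c ∈ block m k i) :
    c ∈ (commonPrivate m n k).A l ↔ l = i := by
  have hmc := le_of_mem_block hc
  constructor
  · intro h
    rcases Finset.mem_union.1 h with h | h
    · exact eq_of_mem_block h hc
    · split_ifs at h
      · exact absurd (Finset.mem_range.1 h) (by omega)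
      · simp at h
  · rintro rfl
    exact Finset.mem_union_left _ hc

/-- If no Pigou–Dalton transfer is possible and the last `n - m` voters cannot be given `m`
committee members each, then the first `m` voters get at most `m` committee members each. -/
theorem card_ballot_inter_le {m n k : ℕ} {W : Finset ℕ} (hW : W ⊆ (commonPrivate m n k).C)
    (hWk : W.card ≤ k) (hk : k < (n - m) * m)
    (hPD : ¬ AdmitsPD (commonPrivate m n k) W) {j : ℕ} (hj : j < m) :
    ((commonPrivate m n k).A j ∩ W).card ≤ m := by
  by_contra! hlt
  obtain ⟨a, ha⟩ : (block m k j ∩ W).Nonempty := by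
    by_contra hempty
    rw [Finset.not_nonempty_iff_eq_empty] at hempty
    have hsub : (commonPrivate m n k).A j ∩ W ⊆ Finset.range m := by
      simp only [commonPrivate, if_pos hj, Finset.union_inter_distrib_right, hempty,
        Finset.empty_union]
      exact Finset.inter_subset_left
    have := Finset.card_le_card hsub
    rw [Finset.card_range] at this
    omega
  obtain ⟨haj, haW⟩ := Finset.mem_inter.1 ha
  have hrich : ∀ i ∈ Finset.Ico m n, m ≤ (block m k i ∩ W).card := by
    intro i hi
    rw [Finset.mem_Ico] at hi
    by_contra! hpoor
    obtain ⟨b, hb, hbW⟩ : ∃ b ∈ block m k i, b ∉ W := by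
      by_contra! hsub
      have hsub' : block m k i ⊆ W.erase a := fun c hc =>
        Finset.mem_erase.2 ⟨fun h => absurd (eq_of_mem_block (h ▸ hc) haj) (by omega),
          hsub c hc⟩
      have hle := Finset.card_le_card hsub'
      have := Finset.card_erase_lt_of_mem haW
      rw [card_block] at hle
      omega
    have hA : (commonPrivate m n k).A i = block m k i := by
      simp [commonPrivate, Nat.not_lt.2 hi.1]
    refine hPD (admitsPD_of_swap hW (i := i) (j := j) (a := a) (b := b)
      (Finset.mem_range.2 hi.2) (Finset.mem_range.2 (by omega))
      (block_subset_range hi.2 hb) haW hbW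
      (fun l _ => mem_ballot_iff_of_mem_block haj) (fun l _ => mem_ballot_iff_of_mem_block hb) ?_)
    rw [hA]
    omega
  have hdisj : (Finset.Ico m n : Set ℕ).PairwiseDisjoint (fun i => block m k i ∩ W) := by
    intro i _ i' _ hne
    refine Finset.disjoint_left.2 fun c hc hc' => hne ?_
    exact eq_of_mem_block (Finset.mem_inter.1 hc).1 (Finset.mem_inter.1 hc').1
  have hsum := Finset.card_nsmul_le_sum _ _ _ hrich
  rw [← Finset.card_biUnion hdisj, Nat.card_Ico, smul_eq_mul] at hsum
  have hle : ((Finset.Ico m n).biUnion fun i => block m k i ∩ W).card ≤ W.card :=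
    Finset.card_le_card (Finset.biUnion_subset.2 fun _ _ => Finset.inter_subset_right)
  omega

/-- The first `m` voters can jointly secure `m + p` approved candidates each whenever they are
entitled to `m + m * p` seats. -/
theorem not_inLamCore_commonPrivate {m n k p : ℕ} {lam : ℝ} {W : Finset ℕ} (hm : 0 < m)
    (hmn : m ≤ n) (hpk : p ≤ k) (hcost : (m + m * p) * n ≤ m * k)
    (hgain : ∀ j < m,
      max (lam * (((commonPrivate m n k).A j ∩ W).card : ℝ)) 1 < ((m + p : ℕ) : ℝ)) :
    ¬ InLamCore lam (commonPrivate m n k) W := by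
  let Q : ℕ → Finset ℕ := fun i => Finset.Ico (m + i * k) (m + i * k + p)
  have hQ : ∀ i, Q i ⊆ block m k i := fun i =>
    Finset.Ico_subset_Ico le_rfl (Nat.add_le_add_left hpk _)
  refine not_not.2 ⟨Finset.range m, Finset.range m ∪ (Finset.range m).biUnion Q,
    Finset.range_subset_range.2 hmn, ⟨0, Finset.mem_range.2 hm⟩, ?_, ?_, fun j hj => ?_⟩
  · refine Finset.union_subset (Finset.range_subset_range.2 (Nat.le_add_right _ _)) ?_
    refine Finset.biUnion_subset.2 fun i hi => (hQ i).trans (block_subset_range ?_)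
    exact (Finset.mem_range.1 hi).trans_le hmn
  · have hcard : (Finset.range m ∪ (Finset.range m).biUnion Q).card ≤ m + m * p := by
      refine (Finset.card_union_le _ _).trans ?_
      have := Finset.card_biUnion_le_card_mul (Finset.range m) Q p fun i _ => by simp [Q]
      simpa using this
    simpa [commonPrivate] using (Nat.mul_le_mul_right n hcard).trans hcost
  · have hj' := Finset.mem_range.1 hj
    refine (hgain j hj').trans_le (Nat.cast_le.2 ?_)
    have hdisj : Disjoint (Finset.range m) (Q j) := Finset.disjoint_left.2 fun c hc hc' =>
      absurd (le_of_mem_block (hQ j hc')) (by simpa using hc)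
    have hsub : Finset.range m ∪ Q j ⊆ (commonPrivate m n k).A j ∩
        (Finset.range m ∪ (Finset.range m).biUnion Q) := by
      refine Finset.subset_inter ?_ ?_
      · simp only [commonPrivate, if_pos hj']
        rw [Finset.union_comm]
        exact Finset.union_subset_union_left (hQ j)
      · exact Finset.union_subset_union_right (Finset.subset_biUnion_of_mem Q hj)
    have := Finset.card_le_card hsub
    rwa [Finset.card_union_of_disjoint hdisj, Finset.card_range, Nat.card_Ico,
      Nat.add_sub_cancel_left] at this

/-- For every `ε > 0`, there is no committee rule that satisfies the
Pigou–Dalton principle and whose every output committee is in the `(2−ε)`-core. -/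
theorem no_pigou_dalton_approx_core (ε : ℝ) (hε : 0 < ε) :
    ¬ ∃ f : Election → Set (Finset ℕ), CommitteeRule f ∧
      (∀ E : Election, E.Valid → ∀ W ∈ f E, ¬ AdmitsPD E W) ∧
      (∀ E : Election, E.Valid → ∀ W ∈ f E, InLamCore (2 - ε) E W) := by
  rintro ⟨f, hf, hPD, hcore⟩
  obtain ⟨q, hq⟩ := exists_nat_gt (2 / ε)
  rw [div_lt_iff₀ hε] at hq
  let m := q + 2
  let n := m + m ^ 2
  let k := n * (q + 1)
  have hmn : m ≤ n := Nat.le_add_right _ _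
  have hvalid : (commonPrivate m n k).Valid :=
    commonPrivate_valid (by positivity) (by positivity)
  obtain ⟨⟨W, hW⟩, hcomm⟩ := hf _ hvalid
  obtain ⟨hWC, hWk⟩ := hcomm W hW
  have hkm : k < (n - m) * m := by
    simp only [k, n, m, Nat.add_sub_cancel_left]
    nlinarith
  refine not_inLamCore_commonPrivate (p := q) (by positivity) hmn ?_ ?_ (fun j hj => ?_)
    (hcore _ hvalid W hW)
  · simp only [k, n, m]
    nlinarith
  · simp only [k, m]
    exact le_of_eq (by ring)
  · have hle := card_ballot_inter_le hWC hWk hkm (hPD _ hvalid W hW) hj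
    set u := ((commonPrivate m n k).A j ∩ W).card
    have hq0 : (0 : ℝ) ≤ q := q.cast_nonneg
    have hu : (u : ℝ) ≤ q + 2 := by exact_mod_cast hle
    have hmq : ((m + q : ℕ) : ℝ) = 2 * q + 2 := by
      simp only [m]
      push_cast
      ring
    rw [hmq, max_lt_iff]
    refine ⟨?_, by linarith⟩
    rcases le_or_gt (u : ℝ) q with h | h
    · nlinarith [mul_nonneg hε.le (Nat.cast_nonneg (α := ℝ) u)]
    · nlinarith

end ABC
end

section
/- PAV satisfies the 2-core property: for every election instance (P,k), every committee W of size at most k with maximal PAV score is in the 2-core. -/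
/-!
Common framework for approval-based committee elections
(Peters & Skowron, "Proportionality and the Limits of Welfarism").
-/

namespace ABC

theorem hsum_succ (t : ℕ) : hsum (t + 1) = hsum t + 1 / ((t : ℝ) + 1) := by
  simp [hsum, Finset.sum_range_succ]

/-- The increase in PAV score when `d` joins the committee `W`. -/
noncomputable def pavGain (E : Election) (W : Finset ℕ) (d : ℕ) : ℝ :=
  ∑ i ∈ E.N, if d ∈ E.A i then 1 / (((E.A i ∩ W).card : ℝ) + 1) else 0

theorem pavScore_insert (E : Election) {W : Finset ℕ} {d : ℕ} (hd : d ∉ W) :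
    pavScore E (insert d W) = pavScore E W + pavGain E W d := by
  unfold pavScore pavGain
  rw [← Finset.sum_add_distrib]
  refine Finset.sum_congr rfl fun i _ => ?_
  split_ifs with h
  · rw [Finset.inter_insert_of_mem h, Finset.card_insert_of_notMem (by simp [hd]), hsum_succ]
  · rw [Finset.inter_insert_of_notMem h, add_zero]

/-- The decrease in PAV score when `c` leaves the committee `V`. -/
noncomputable def pavLoss (E : Election) (V : Finset ℕ) (c : ℕ) : ℝ :=
  ∑ i ∈ E.N, if c ∈ E.A i then 1 / ((E.A i ∩ V).card : ℝ) else 0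

theorem pavScore_erase (E : Election) {V : Finset ℕ} {c : ℕ} (hc : c ∈ V) :
    pavScore E (V.erase c) = pavScore E V - pavLoss E V c := by
  have h := pavScore_insert E (Finset.notMem_erase c V)
  rw [Finset.insert_erase hc] at h
  have hgain : pavGain E (V.erase c) c = pavLoss E V c := by
    refine Finset.sum_congr rfl fun i _ => ?_
    split_ifs with hi
    · have hcard : (E.A i ∩ V.erase c).card + 1 = (E.A i ∩ V).card := by
        rw [Finset.inter_erase]
        exact Finset.card_erase_add_one (Finset.mem_inter.2 ⟨hi, hc⟩)
      rw [← hcard]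
      push_cast
      rfl
    · rfl
  linarith

theorem sum_pavLoss_insert_le (E : Election) {W : Finset ℕ} {d : ℕ} (hd : d ∉ W) :
    ∑ c ∈ W, pavLoss E (insert d W) c ≤ (E.N.card : ℝ) - pavGain E W d := by
  unfold pavLoss pavGain
  rw [Finset.sum_comm, Finset.card_eq_sum_ones, Nat.cast_sum, ← Finset.sum_sub_distrib]
  refine Finset.sum_le_sum fun i _ => ?_
  rw [← Finset.sum_filter, Finset.sum_const, nsmul_eq_mul, Finset.filter_mem_eq_inter,
    Finset.inter_comm W]
  split_ifs with h
  · rw [Finset.inter_insert_of_mem h, Finset.card_insert_of_notMem (by simp [hd])]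
    push_cast
    apply le_of_eq
    field_simp
    ring
  · rw [Finset.inter_insert_of_notMem h, mul_one_div]
    simpa using div_self_le_one ((E.A i ∩ W).card : ℝ)

theorem PavWinner.pavGain_le {E : Election} {W : Finset ℕ} (hW : PavWinner E W) {d : ℕ}
    (hdC : d ∈ E.C) (hd : d ∉ W) : ((E.k : ℝ) + 1) * pavGain E W d ≤ E.N.card := by
  obtain ⟨hWC, hWk, hmax⟩ := hW
  have hVC : insert d W ⊆ E.C := Finset.insert_subset hdC hWC
  rcases hWk.lt_or_eq with hlt | heq
  · have h := hmax (insert d W) hVC (by rw [Finset.card_insert_of_notMem hd]; omega)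
    rw [pavScore_insert E hd] at h
    have hgain : pavGain E W d ≤ 0 := by linarith
    calc ((E.k : ℝ) + 1) * pavGain E W d ≤ 0 :=
          mul_nonpos_of_nonneg_of_nonpos (by positivity) hgain
      _ ≤ E.N.card := by positivity
  · have hswap : ∀ c ∈ W, pavGain E W d ≤ pavLoss E (insert d W) c := by
      intro c hc
      have hcV : c ∈ insert d W := Finset.mem_insert_of_mem hc
      have h := hmax ((insert d W).erase c) ((Finset.erase_subset _ _).trans hVC) (by
        rw [Finset.card_erase_of_mem hcV, Finset.card_insert_of_notMem hd]; omega)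
      rw [pavScore_erase E hcV, pavScore_insert E hd] at h
      linarith
    have hsum := Finset.card_nsmul_le_sum W _ _ hswap
    rw [nsmul_eq_mul, heq] at hsum
    linarith [sum_pavLoss_insert_le E hd]

theorem card_le_sum_pavGain (E : Election) {W S T : Finset ℕ} (hS : S ⊆ E.N)
    (h : ∀ i ∈ S, 2 * (E.A i ∩ W).card < (E.A i ∩ T).card) :
    (S.card : ℝ) ≤ ∑ d ∈ T \ W, pavGain E W d := by
  unfold pavGain
  rw [Finset.sum_comm, Finset.card_eq_sum_ones, Nat.cast_sum]
  refine (Finset.sum_le_sum fun i hi => ?_).trans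
    (Finset.sum_le_sum_of_subset_of_nonneg hS fun i _ _ =>
      Finset.sum_nonneg fun d _ => by split_ifs <;> positivity)
  rw [← Finset.sum_filter, Finset.sum_const, nsmul_eq_mul, Finset.filter_mem_eq_inter,
    mul_one_div, Nat.cast_one, one_le_div (by positivity)]
  have hsub : E.A i ∩ T ⊆ (T \ W) ∩ E.A i ∪ E.A i ∩ W := by
    intro x
    simp only [Finset.mem_inter, Finset.mem_union, Finset.mem_sdiff]
    tauto
  have hcard := (Finset.card_le_card hsub).trans (Finset.card_union_le _ _)
  have hlt := h i hi
  exact_mod_cast (by omega : (E.A i ∩ W).card + 1 ≤ ((T \ W) ∩ E.A i).card)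

/-- PAV satisfies the 2-core property: every committee of size at
most `k` with maximal PAV score is in the 2-core. -/
theorem pav_two_core (E : Election) (hE : E.Valid)
    (W : Finset ℕ) (hW : PavWinner E W) :
    InLamCore 2 E W := by
  rintro ⟨S, T, hSN, hSne, hTC, hcard, hST⟩
  have hgain := card_le_sum_pavGain E (W := W) (T := T) hSN fun i hi => by
    exact_mod_cast (le_max_left _ _).trans_lt (hST i hi)
  have hle : ∑ d ∈ T \ W, ((E.k : ℝ) + 1) * pavGain E W d ≤ (T \ W).card * (E.N.card : ℝ) := by
    rw [← nsmul_eq_mul]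
    refine Finset.sum_le_card_nsmul _ _ _ fun d hd => ?_
    obtain ⟨hdT, hdW⟩ := Finset.mem_sdiff.1 hd
    exact hW.pavGain_le (hTC hdT) hdW
  rw [← Finset.mul_sum] at hle
  have hUT : ((T \ W).card : ℝ) * E.N.card ≤ T.card * E.N.card := by
    gcongr
    exact Finset.sdiff_subset
  have hcard' : (T.card : ℝ) * E.N.card ≤ S.card * E.k := by exact_mod_cast hcard
  have hSpos : (0 : ℝ) < S.card := by exact_mod_cast hSne.card_pos
  have hmul := mul_le_mul_of_nonneg_left hgain (by positivity : (0 : ℝ) ≤ (E.k : ℝ) + 1)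
  linarith

end ABC
end

section
/- Rule X satisfies the O(log k)-core property: for every election instance (P,k), every committee W that Rule X can output (under any tie-breaking) is in the λ-core for λ = 4·ln(2k) + 1. -/
/-!
Common framework for approval-based committee elections
(Peters & Skowron, "Proportionality and the Limits of Welfarism").
-/

namespace ABC

theorem RuleXReach.budget_nonneg {E : Election} {b : ℕ → ℝ} {W : Finset ℕ}
    (h : RuleXReach E b W) (i : ℕ) : 0 ≤ b i := by
  induction h with
  | init => norm_num
  | @step b W c q _ _ _ ih =>
    dsimp only
    split_ifs
    · exact sub_nonneg.2 (min_le_right _ _)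
    · exact ih

/-- A group of approvers of `c` that can pay `x` each is small unless `c` is `x`-affordable. -/
theorem RuleXReach.card_mul_le_price {E : Election} {b : ℕ → ℝ} {W V : Finset ℕ} {c : ℕ} {x : ℝ}
    (h : RuleXReach E b W) (hc : c ∈ E.C) (hcW : c ∉ W) (hx : 0 ≤ x)
    (hV : V ⊆ E.approvers c) (hb : ∀ i ∈ V, x ≤ b i) (hna : ¬ Affordable E b W c x) :
    V.card * x ≤ E.price := by
  have hlt : ∑ i ∈ E.approvers c, min x (b i) < E.price := by
    by_contra! hle
    exact hna ⟨hc, hcW, hx, hle⟩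
  calc (V.card : ℝ) * x = ∑ i ∈ V, min x (b i) := by
        rw [Finset.sum_congr rfl fun i hi => min_eq_left (hb i hi)]
        simp
    _ ≤ ∑ i ∈ E.approvers c, min x (b i) :=
        Finset.sum_le_sum_of_subset_of_nonneg hV fun i _ _ =>
          le_min hx (h.budget_nonneg i)
    _ ≤ E.price := hlt.le

theorem inv_le_budget {b : ℝ} {u v : ℕ} (hb : 1 - b ≤ u * ((v : ℝ) + 1)⁻¹) (huv : u ≤ v) :
    ((v : ℝ) + 1)⁻¹ ≤ b := by
  have huv' : (u : ℝ) ≤ v := by exact_mod_cast huv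
  have hv : (0 : ℝ) < (v : ℝ) + 1 := by positivity
  have hmul : (u : ℝ) * ((v : ℝ) + 1)⁻¹ ≤ v * ((v : ℝ) + 1)⁻¹ := by gcongr
  have hone : ((v : ℝ) + 1) * ((v : ℝ) + 1)⁻¹ = 1 := mul_inv_cancel₀ hv.ne'
  linarith

/-- As long as an unelected candidate `c` has more than `(v + 1) * n / k` approvers with at most
`v` representatives, no voter has paid more than `1 / (v + 1)` for any candidate. -/
theorem RuleXReach.spent_le_or_card_le {E : Election} {b : ℕ → ℝ} {W V : Finset ℕ} {c v : ℕ}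
    (h : RuleXReach E b W) (hc : c ∈ E.C) (hV : V ⊆ E.approvers c) (hcW : c ∉ W)
    (hu : ∀ i ∈ V, (E.A i ∩ W).card ≤ v) :
    (∀ i, 1 - b i ≤ (E.A i ∩ W).card * ((v : ℝ) + 1)⁻¹) ∨
      V.card * ((v : ℝ) + 1)⁻¹ ≤ E.price := by
  induction h with
  | init => simp
  | @step b W d q hr haff hmin ih =>
    have hcW' : c ∉ W := fun hm => hcW (Finset.mem_insert_of_mem hm)
    have hmono : ∀ i, (E.A i ∩ W).card ≤ (E.A i ∩ insert d W).card := fun i =>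
      Finset.card_le_card (Finset.inter_subset_inter_left (Finset.subset_insert d W))
    have hu' : ∀ i ∈ V, (E.A i ∩ W).card ≤ v := fun i hi => (hmono i).trans (hu i hi)
    have hx : (0 : ℝ) ≤ ((v : ℝ) + 1)⁻¹ := by positivity
    rcases ih hcW' hu' with hspent | hcard
    · rcases le_or_gt q ((v : ℝ) + 1)⁻¹ with hq | hq
      · left
        intro i
        dsimp only
        split_ifs with hi
        · have hdA : d ∈ E.A i := (Finset.mem_filter.1 hi).2
          have hcard : (E.A i ∩ insert d W).card = (E.A i ∩ W).card + 1 := by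
            rw [Finset.inter_insert_of_mem hdA, Finset.card_insert_of_notMem]
            exact fun hm => haff.2.1 (Finset.mem_inter.1 hm).2
          rw [hcard]
          push_cast
          have := hspent i
          have := min_le_left q (b i)
          linarith
        · refine (hspent i).trans ?_
          have : ((E.A i ∩ W).card : ℝ) ≤ (E.A i ∩ insert d W).card := by
            exact_mod_cast hmono i
          gcongr
      · right
        exact hr.card_mul_le_price hc hcW' hx hV
          (fun i hi => inv_le_budget (hspent i) (hu' i hi))
          fun ha => absurd (hmin c _ ha) (not_le.2 hq)
    · exact Or.inr hcard

/-- At most `(v + 1) * n / k` approvers of an unelected candidate have at most `v`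
representatives. -/
theorem RuleXOutput.card_le {E : Election} {W V : Finset ℕ} {c v : ℕ} (hW : RuleXOutput E W)
    (hc : c ∈ E.C) (hcW : c ∉ W) (hV : V ⊆ E.approvers c)
    (hu : ∀ i ∈ V, (E.A i ∩ W).card ≤ v) :
    (V.card : ℝ) ≤ E.price * (v + 1) := by
  obtain ⟨b, hr, hend⟩ := hW
  have hv : (0 : ℝ) < (v : ℝ) + 1 := by positivity
  rw [← div_le_iff₀ hv, div_eq_mul_inv]
  rcases hr.spent_le_or_card_le hc hV hcW hu with hspent | hcard
  · exact hr.card_mul_le_price hc hcW (by positivity) hV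
      (fun i hi => inv_le_budget (hspent i) (hu i hi)) (hend c _)
  · exact hcard

theorem one_div_le_add_sum_ite {u : ℕ} (hu : 1 ≤ u) (m : ℕ) :
    1 / (u : ℝ) ≤ 1 / ((m : ℝ) + 1) + ∑ v ∈ Finset.range m,
      if u ≤ v + 1 then 1 / (((v : ℝ) + 1) * (v + 2)) else 0 := by
  induction m with
  | zero =>
    have : (1 : ℝ) ≤ u := by exact_mod_cast hu
    simpa using inv_le_one_of_one_le₀ this
  | succ m ih =>
    rw [Finset.sum_range_succ]
    split_ifs with h
    · have : 1 / ((m : ℝ) + 1) = 1 / ((m + 1 : ℕ) + 1) + 1 / (((m : ℝ) + 1) * (m + 2)) := by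
        push_cast
        field_simp
        ring
      linarith
    · have hle : ((m + 1 : ℕ) : ℝ) + 1 ≤ u := by exact_mod_cast not_le.1 h
      have h1 : 1 / (u : ℝ) ≤ 1 / (((m + 1 : ℕ) : ℝ) + 1) :=
        one_div_le_one_div_of_le (by positivity) hle
      have h2 : 0 ≤ ∑ v ∈ Finset.range m,
          if u ≤ v + 1 then 1 / (((v : ℝ) + 1) * (v + 2)) else 0 :=
        Finset.sum_nonneg fun v _ => by split_ifs <;> positivity
      linarith

theorem one_add_hsum_le_two_mul_log (m : ℕ) :
    1 + hsum m ≤ 2 * Real.log (2 * ((m : ℝ) + 1)) := by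
  induction m with
  | zero =>
    have := Real.log_two_gt_d9
    simp only [hsum, Finset.range_zero, Finset.sum_empty, Nat.cast_zero, zero_add, mul_one]
    linarith
  | succ m ih =>
    have hm : (0 : ℝ) < (m : ℝ) + 1 := by positivity
    have hsucc : hsum (m + 1) = hsum m + 1 / ((m : ℝ) + 1) := Finset.sum_range_succ _ m
    have hlog : Real.log (2 * (((m + 1 : ℕ) : ℝ) + 1)) =
        Real.log (2 * ((m : ℝ) + 1)) + Real.log (((m : ℝ) + 2) / (m + 1)) := by
      rw [← Real.log_mul (by positivity) (by positivity)]
      congr 1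
      push_cast
      field_simp
      ring
    have hlow := Real.one_sub_inv_le_log_of_pos (x := ((m : ℝ) + 2) / (m + 1)) (by positivity)
    have hfrac : 1 / ((m : ℝ) + 1) ≤ 2 * (1 - (((m : ℝ) + 2) / (m + 1))⁻¹) := by
      have : 2 * (1 - (((m : ℝ) + 2) / (m + 1))⁻¹) = 2 / ((m : ℝ) + 2) := by
        field_simp
        ring
      rw [this, div_le_div_iff₀ hm (by positivity)]
      linarith [m.cast_nonneg (α := ℝ)]
    rw [hsucc, hlog]
    linarith

/-- If the number of indices with `u i ≤ v` grows at most linearly in `v`, then the sum of the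
reciprocals `1 / u i` grows at most logarithmically. -/
theorem sum_one_div_le_log {M : Finset ℕ} {u : ℕ → ℕ} {p : ℝ} {k : ℕ} (hk : 0 < k) (hp : 0 ≤ p)
    (hu : ∀ i ∈ M, 1 ≤ u i) (hM : (M.card : ℝ) ≤ p * k)
    (hcount : ∀ v : ℕ, ((M.filter fun i => u i ≤ v).card : ℝ) ≤ p * (v + 1)) :
    ∑ i ∈ M, 1 / (u i : ℝ) ≤ p * (2 * Real.log (2 * (k : ℝ))) := by
  obtain ⟨m, rfl⟩ : ∃ m, k = m + 1 := ⟨k - 1, by omega⟩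
  push_cast at hM ⊢
  have hm : (0 : ℝ) < (m : ℝ) + 1 := by positivity
  calc ∑ i ∈ M, 1 / (u i : ℝ)
      ≤ ∑ i ∈ M, (1 / ((m : ℝ) + 1) + ∑ v ∈ Finset.range m,
          if u i ≤ v + 1 then 1 / (((v : ℝ) + 1) * (v + 2)) else 0) :=
        Finset.sum_le_sum fun i hi => one_div_le_add_sum_ite (hu i hi) m
    _ = M.card / ((m : ℝ) + 1) + ∑ v ∈ Finset.range m,
          (M.filter fun i => u i ≤ v + 1).card * (1 / (((v : ℝ) + 1) * (v + 2))) := by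
        rw [Finset.sum_add_distrib, Finset.sum_comm]
        simp [← Finset.sum_filter, div_eq_mul_inv]
    _ ≤ p + ∑ v ∈ Finset.range m, p * (1 / ((v : ℝ) + 1)) := by
        refine add_le_add ((div_le_iff₀ hm).2 hM) (Finset.sum_le_sum fun v _ => ?_)
        have hv := hcount (v + 1)
        push_cast at hv
        calc ((M.filter fun i => u i ≤ v + 1).card : ℝ) * (1 / (((v : ℝ) + 1) * (v + 2)))
            ≤ p * ((v : ℝ) + 1 + 1) * (1 / (((v : ℝ) + 1) * (v + 2))) := by gcongr
          _ = p * (1 / ((v : ℝ) + 1)) := by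
            field_simp
            ring
    _ = p * (1 + hsum m) := by
        rw [← Finset.mul_sum, hsum]
        ring
    _ ≤ p * (2 * Real.log (2 * ((m : ℝ) + 1))) := by
        gcongr
        exact one_add_hsum_le_two_mul_log m

theorem sum_card_inter_mul (E : Election) {S : Finset ℕ} (hS : S ⊆ E.N) (T : Finset ℕ)
    (w : ℕ → ℝ) :
    ∑ i ∈ S, ((E.A i ∩ T).card : ℝ) * w i =
      ∑ c ∈ T, ∑ i ∈ S ∩ E.approvers c, w i := by
  have hinter : ∀ c, S ∩ E.approvers c = S.filter fun i => c ∈ E.A i := by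
    intro c
    ext i
    simp only [Election.approvers, Finset.mem_inter, Finset.mem_filter]
    exact ⟨fun h => ⟨h.1, h.2.2⟩, fun h => ⟨h.1, hS h.1, h.2⟩⟩
  simp_rw [hinter, Finset.sum_filter]
  rw [Finset.sum_comm]
  refine Finset.sum_congr rfl fun i _ => ?_
  rw [← Finset.sum_filter, Finset.sum_const, nsmul_eq_mul, Finset.inter_comm,
    Finset.filter_mem_eq_inter]

/-- Rule X satisfies the `O(log k)`-core property: every committee
that Rule X can output is in the `λ`-core for `λ = 4·ln(2k) + 1`. -/
theorem ruleX_log_core (E : Election) (hE : E.Valid)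
    (W : Finset ℕ) (hW : RuleXOutput E W) :
    InLamCore (4 * Real.log (2 * (E.k : ℝ)) + 1) E W := by
  rintro ⟨S, T, hSN, hSne, hTC, hTS, hST⟩
  obtain ⟨-, -, hk, hn⟩ := hE
  set L := Real.log (2 * (E.k : ℝ))
  have hkR : (1 : ℝ) ≤ E.k := by exact_mod_cast hk
  have hLpos : 0 < L := Real.log_pos (by linarith)
  have hprice : 0 ≤ E.price := by unfold Election.price; positivity
  have hpk : E.price * E.k = E.N.card := by unfold Election.price; field_simp
  set T' := T \ W with hT'
  have hbudget : T'.card * E.price ≤ (S.card : ℝ) := by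
    have h1 : (T'.card : ℝ) ≤ T.card := by exact_mod_cast Finset.card_le_card Finset.sdiff_subset
    have h2 : (T.card : ℝ) * E.N.card ≤ S.card * E.k := by exact_mod_cast hTS
    refine (mul_le_mul_of_nonneg_right h1 hprice).trans ?_
    unfold Election.price
    rw [← mul_div_assoc, div_le_iff₀ (by linarith)]
    exact h2
  have hmemT' : ∀ c ∈ T', c ∈ E.C ∧ c ∉ W := fun c hc =>
    ⟨hTC (Finset.mem_sdiff.1 hc).1, (Finset.mem_sdiff.1 hc).2⟩
  have hsplit : ∀ i, ((E.A i ∩ T).card : ℝ) ≤ (E.A i ∩ T').card + (E.A i ∩ W).card := by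
    intro i
    have : E.A i ∩ T ⊆ (E.A i ∩ T') ∪ (E.A i ∩ W) := by
      intro c
      simp only [hT', Finset.mem_union, Finset.mem_inter, Finset.mem_sdiff]
      tauto
    exact_mod_cast (Finset.card_le_card this).trans (Finset.card_union_le _ _)
  set S₀ := S.filter fun i => (E.A i ∩ W).card = 0
  set S₁ := S.filter fun i => ¬ (E.A i ∩ W).card = 0
  have hcardS : (S₀.card : ℝ) + S₁.card = S.card := by
    exact_mod_cast Finset.card_filter_add_card_filter_not (s := S) fun i => (E.A i ∩ W).card = 0
  have hunrep : 2 * (S₀.card : ℝ) ≤ S.card := by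
    calc 2 * (S₀.card : ℝ) = ∑ i ∈ S₀, 2 := by simp [mul_comm]
      _ ≤ ∑ i ∈ S₀, ((E.A i ∩ T').card : ℝ) * 1 := by
        refine Finset.sum_le_sum fun i hi => ?_
        obtain ⟨hiS, hi0⟩ := Finset.mem_filter.1 hi
        have h1 := (le_max_right _ _).trans_lt (hST i hiS)
        have h2 : (2 : ℝ) ≤ (E.A i ∩ T).card := by
          have : 1 < (E.A i ∩ T).card := by exact_mod_cast h1
          exact_mod_cast this
        have h3 := hsplit i
        rw [hi0] at h3
        push_cast at h3
        linarith
      _ = ∑ c ∈ T', ∑ i ∈ S₀ ∩ E.approvers c, (1 : ℝ) :=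
        sum_card_inter_mul E ((Finset.filter_subset _ _).trans hSN) T' fun _ => 1
      _ ≤ ∑ c ∈ T', E.price := by
        refine Finset.sum_le_sum fun c hc => ?_
        have := hW.card_le (V := S₀ ∩ E.approvers c) (v := 0) (hmemT' c hc).1 (hmemT' c hc).2
          Finset.inter_subset_right
          fun i hi => (Finset.mem_filter.1 (Finset.mem_inter.1 hi).1).2.le
        simpa using this
      _ ≤ S.card := by simpa using hbudget
  have hne : S₁.Nonempty := by
    rw [Finset.nonempty_iff_ne_empty]
    intro he
    have hpos : (0 : ℝ) < S.card := by exact_mod_cast hSne.card_pos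
    rw [he, Finset.card_empty] at hcardS
    push_cast at hcardS
    linarith
  have hrep : 4 * L * S₁.card < 2 * L * S.card := by
    calc 4 * L * (S₁.card : ℝ) = ∑ i ∈ S₁, 4 * L := by simp [mul_comm]
      _ < ∑ i ∈ S₁, ((E.A i ∩ T').card : ℝ) * (1 / ((E.A i ∩ W).card : ℝ)) := by
        refine Finset.sum_lt_sum_of_nonempty hne fun i hi => ?_
        obtain ⟨hiS, hi0⟩ := Finset.mem_filter.1 hi
        have hpos : (0 : ℝ) < (E.A i ∩ W).card := by exact_mod_cast Nat.pos_of_ne_zero hi0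
        have h1 := (le_max_left _ _).trans_lt (hST i hiS)
        have h2 := hsplit i
        rw [mul_one_div, lt_div_iff₀ hpos]
        linarith
      _ = ∑ c ∈ T', ∑ i ∈ S₁ ∩ E.approvers c, 1 / ((E.A i ∩ W).card : ℝ) :=
        sum_card_inter_mul E ((Finset.filter_subset _ _).trans hSN) T' _
      _ ≤ ∑ c ∈ T', E.price * (2 * L) := by
        refine Finset.sum_le_sum fun c hc => ?_
        refine sum_one_div_le_log hk hprice (fun i hi => ?_) ?_ fun v => ?_
        · exact Nat.one_le_iff_ne_zero.2 (Finset.mem_filter.1 (Finset.mem_inter.1 hi).1).2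
        · rw [hpk]
          exact_mod_cast Finset.card_le_card
            (Finset.inter_subset_right.trans (Finset.filter_subset _ _))
        · exact hW.card_le (hmemT' c hc).1 (hmemT' c hc).2
            ((Finset.filter_subset _ _).trans Finset.inter_subset_right)
            fun i hi => (Finset.mem_filter.1 hi).2
      _ = 2 * L * (T'.card * E.price) := by
        rw [Finset.sum_const, nsmul_eq_mul]
        ring
      _ ≤ 2 * L * S.card := by gcongr
  have hhalf : 2 * (S₁.card : ℝ) < S.card := by
    by_contra! hle
    have := mul_le_mul_of_nonneg_left hle (mul_pos two_pos hLpos).le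
    linarith
  linarith

end ABC
end
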